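/- arXiv:2010.08594 — 4 statements merged into one kernel-verified Lean document; each statement's English description precedes it below -/
import Mathlib

section
/- For every integer n ≥ 2, the subgroup Γ_n = {g ∈ SL_n(O_L) : τ(gᵀ)·D_n·g = D_n}, viewed inside SL_n(ℝ) via the inclusion L ⊂ ℝ, is a cocompact lattice in SL_n(ℝ): it is a discrete subgroup and the quotient space SL_n(ℝ)/Γ_n is compact. -/
open IntermediateField Polynomial Matrix

/-- The real fourth root of `2`. -/
noncomputable def alpha : ℝ := (2 : ℝ) ^ ((1 : ℝ) / 4)

/-- The number field `L = ℚ(2^{1/4})`, as a subfield of `ℝ`. -/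
noncomputable def L : IntermediateField ℚ ℝ := ℚ⟮alpha⟯

noncomputable def alphaL : L := ⟨alpha, IntermediateField.mem_adjoin_simple_self ℚ alpha⟩

/-- The matrix `D_n = diag(-1, √2, ..., √2)` over `L`, where `√2 = α²`. -/
noncomputable def Dmat (n : ℕ) : Matrix (Fin n) (Fin n) L :=
  Matrix.diagonal fun i => if (i : ℕ) = 0 then -1 else alphaL ^ 2

/-- The natural topology on `SL_n(ℝ)`, induced from the space of matrices. -/
instance (n : ℕ) : TopologicalSpace (Matrix.SpecialLinearGroup (Fin n) ℝ) :=
  TopologicalSpace.induced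
    (fun g => (g : Matrix (Fin n) (Fin n) ℝ)) inferInstance

/-! ### Minkowski's theorem on linear forms -/

theorem minkowski_forms {ι : Type} [Fintype ι] [DecidableEq ι] (M : Matrix ι ι ℝ)
    (hdet : M.det ≠ 0) (a : ℝ) (ha : 0 < a) (h : |M.det| < a ^ Fintype.card ι) :
    ∃ z : ι → ℤ, z ≠ 0 ∧ ∀ i, |(M *ᵥ (fun j => (z j : ℝ))) i| ≤ a := by
  classical
  set b : Module.Basis ι ℝ (ι → ℝ) := Pi.basisFun ℝ ι with hb
  set s : Set (ι → ℝ) := (Matrix.toLin' M) ⁻¹' (Metric.ball 0 a) with hs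
  have hF := ZSpan.isAddFundamentalDomain' b (MeasureTheory.volume)
  have hvF : MeasureTheory.volume (ZSpan.fundamentalDomain b) = 1 := by
    rw [ZSpan.volume_fundamentalDomain]
    have : (Matrix.of ⇑b) = 1 := by
      ext i j
      simp [hb, Pi.basisFun_apply, Matrix.one_apply, Pi.single_apply, eq_comm]
    rw [this]; simp
  have hvs : MeasureTheory.volume s
      = ENNReal.ofReal (|M.det|⁻¹ * (2 * a) ^ Fintype.card ι) := by
    rw [hs, MeasureTheory.Measure.addHaar_preimage_linearMap _ (by simpa using hdet),
      Real.volume_pi_ball _ ha, ← ENNReal.ofReal_mul (abs_nonneg _)]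
    simp [abs_inv]
  have hpos : 0 < |M.det| := abs_pos.mpr hdet
  have : Countable (Submodule.span ℤ (Set.range b)).toAddSubgroup := by
    have : Countable (Submodule.span ℤ (Set.range b)) := inferInstance
    exact this
  obtain ⟨x, hx0, hxs⟩ :=
    MeasureTheory.exists_ne_zero_mem_lattice_of_measure_mul_two_pow_lt_measure hF
      (s := s) (by
        intro x hx
        simp only [hs, Set.mem_preimage, map_neg, Metric.mem_ball, dist_zero_right, norm_neg]
          at hx ⊢
        exact hx) ((convex_ball (0 : ι → ℝ) a).linear_preimage (Matrix.toLin' M)) (by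
        rw [hvF, hvs, one_mul, Module.finrank_fintype_fun_eq_card]
        have : (2 : ENNReal) ^ Fintype.card ι = ENNReal.ofReal (2 ^ Fintype.card ι) := by
          rw [ENNReal.ofReal_pow (by norm_num)]; simp
        rw [this, ENNReal.ofReal_lt_ofReal_iff (by positivity), mul_pow, ← mul_assoc,
          mul_comm (|M.det|⁻¹), mul_assoc]
        apply lt_mul_of_one_lt_right (by positivity)
        rw [inv_mul_eq_div, one_lt_div hpos]
        exact h)
  have hxm : (x : ι → ℝ) ∈ Submodule.span ℤ (Set.range b) := x.2
  rw [b.mem_span_iff_repr_mem ℤ] at hxm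
  choose z hz using hxm
  have hzx : (fun j => (z j : ℝ)) = (x : ι → ℝ) := by
    funext j
    have := hz j
    simpa [hb] using this
  refine ⟨z, ?_, ?_⟩
  · rintro rfl
    apply hx0
    apply Subtype.ext
    rw [← hzx]
    funext j; simp
  · intro i
    rw [hzx]
    have h1 : ‖M *ᵥ (x : ι → ℝ)‖ < a := by
      simpa [hs, Matrix.toLin'_apply] using hxs
    exact (norm_le_pi_norm (M *ᵥ (x : ι → ℝ)) i).trans h1.le

/-! ### Facts on `alpha` -/

theorem alpha_pos : 0 < alpha := by unfold alpha; positivity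

theorem alpha_pow_four : alpha ^ 4 = 2 := by
  unfold alpha
  rw [← Real.rpow_natCast, ← Real.rpow_mul (by norm_num)]
  norm_num

theorem alpha_sq : alpha ^ 2 = √2 := by
  symm
  rw [Real.sqrt_eq_iff_mul_self_eq (by norm_num) (by positivity)]
  have := alpha_pow_four
  nlinarith [this]

theorem alpha_sq_lt : alpha ^ 2 < 2 := by
  rw [alpha_sq, Real.sqrt_lt' (by norm_num)]; norm_num

theorem one_lt_alpha_sq : 1 < alpha ^ 2 := by
  rw [alpha_sq, Real.lt_sqrt (by norm_num)]; norm_num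

theorem alpha_lt_two : alpha < 2 := by
  nlinarith [alpha_sq_lt, alpha_pos]

/-- `p + q √2 = 0` or `p² - 2q²` has absolute value at least one. -/
theorem int_norm_ge (p q : ℤ) (h : |((p : ℝ) + q * alpha ^ 2) * ((p : ℝ) - q * alpha ^ 2)| < 1) :
    p = 0 ∧ q = 0 := by
  have h4 := alpha_pow_four
  have e : ((p : ℝ) + q * alpha ^ 2) * ((p : ℝ) - q * alpha ^ 2) = ((p ^ 2 - 2 * q ^ 2 : ℤ) : ℝ) := by
    push_cast; linear_combination (-(q : ℝ) ^ 2) * h4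
  rw [e, ← Int.cast_abs] at h
  have h' : |p ^ 2 - 2 * q ^ 2| < 1 := by exact_mod_cast h
  have h0 : p ^ 2 - 2 * q ^ 2 = 0 := Int.abs_lt_one_iff.mp h'
  have hq : q = 0 := by
    by_contra hq
    have hirr := irrational_sqrt_two
    have hq' : (q : ℝ) ≠ 0 := by exact_mod_cast hq
    have h2 : ((p : ℝ) / q) ^ 2 = 2 := by
      have : (p : ℝ) ^ 2 - 2 * q ^ 2 = 0 := by exact_mod_cast h0
      field_simp; linarith
    have h3 : √2 = |(p : ℝ) / q| := by rw [← Real.sqrt_sq_eq_abs, h2]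
    apply hirr
    refine ⟨|(p : ℚ) / q|, ?_⟩
    rw [h3]; push_cast; rfl
  refine ⟨?_, hq⟩
  subst hq
  simpa using h0

/-! ### The real picture -/

/-- Coordinates of the four real components of an element of `ℤ[α]`. -/
noncomputable def Vmat : Matrix (Fin 4) (Fin 4) ℝ :=
  !![1, alpha, alpha ^ 2, alpha ^ 3;
     1, -alpha, alpha ^ 2, -alpha ^ 3;
     1, 0, -alpha ^ 2, 0;
     0, alpha, 0, -alpha ^ 3]

theorem Vmat_det : Vmat.det ≠ 0 := by
  have h : Vmat.det = -8 * alpha ^ 6 := by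
    unfold Vmat
    simp [Matrix.det_succ_row_zero, Fin.sum_univ_succ, Fin.succAbove, Matrix.submatrix]
    ring
  rw [h]
  have := alpha_pos
  have : 0 < alpha ^ 6 := by positivity
  exact ne_of_lt (by linarith)

/-- The entries of `D_n` as reals. -/
noncomputable def dreal (n : ℕ) (i : Fin n) : ℝ := if (i : ℕ) = 0 then -1 else alpha ^ 2

theorem dreal_abs (n : ℕ) (i : Fin n) : |dreal n i| ≤ 2 := by
  unfold dreal
  split_ifs
  · norm_num
  · rw [abs_of_nonneg (by positivity)]; exact alpha_sq_lt.le

noncomputable def cx1 {n : ℕ} (z : Fin n × Fin 4 → ℤ) (i : Fin n) : ℝ :=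
  z (i, 0) + z (i, 1) * alpha + z (i, 2) * alpha ^ 2 + z (i, 3) * alpha ^ 3
noncomputable def cx2 {n : ℕ} (z : Fin n × Fin 4 → ℤ) (i : Fin n) : ℝ :=
  z (i, 0) - z (i, 1) * alpha + z (i, 2) * alpha ^ 2 - z (i, 3) * alpha ^ 3
noncomputable def cx3 {n : ℕ} (z : Fin n × Fin 4 → ℤ) (i : Fin n) : ℝ :=
  z (i, 0) - z (i, 2) * alpha ^ 2
noncomputable def cx4 {n : ℕ} (z : Fin n × Fin 4 → ℤ) (i : Fin n) : ℝ :=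
  z (i, 1) * alpha - z (i, 3) * alpha ^ 3

theorem form_invariant {n : ℕ} (g g' : Matrix (Fin n) (Fin n) ℝ)
    (hg : g'ᵀ * Matrix.diagonal (dreal n) * g = Matrix.diagonal (dreal n)) (x y : Fin n → ℝ) :
    ∑ i, dreal n i * (g' *ᵥ y) i * (g *ᵥ x) i = ∑ i, dreal n i * y i * x i := by
  have h1 : ∀ u v : Fin n → ℝ, ∑ i, dreal n i * u i * v i
      = u ⬝ᵥ (Matrix.diagonal (dreal n) *ᵥ v) := by
    intro u v
    simp only [dotProduct, Matrix.mulVec_diagonal]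
    exact Finset.sum_congr rfl fun i _ => by ring
  rw [h1, h1, ← Matrix.vecMul_transpose, ← Matrix.dotProduct_mulVec, Matrix.mulVec_mulVec,
    Matrix.mulVec_mulVec, hg]

theorem no_small {n : ℕ} (hn : 2 ≤ n) (g g' : Matrix (Fin n) (Fin n) ℝ)
    (hg : g'ᵀ * Matrix.diagonal (dreal n) * g = Matrix.diagonal (dreal n))
    (z : Fin n × Fin 4 → ℤ) (a : ℝ) (ha : a = 1 / (4 * n))
    (h1 : ∀ i, |(g *ᵥ cx1 z) i| ≤ a) (h2 : ∀ i, |(g' *ᵥ cx2 z) i| ≤ a)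
    (h3 : ∀ i, |cx3 z i| ≤ a) (h4 : ∀ i, |cx4 z i| ≤ a) : z = 0 := by
  have hn' : (2 : ℝ) ≤ n := by exact_mod_cast hn
  have hapos : 0 < a := by rw [ha]; positivity
  have hal := alpha_pow_four
  have hsq := alpha_sq_lt
  have hsq1 := one_lt_alpha_sq
  set ε : Fin n → ℤ := fun i => if (i : ℕ) = 0 then -1 else 0 with hε
  set η : Fin n → ℤ := fun i => if (i : ℕ) = 0 then 0 else 1 with hη
  set A : Fin n → ℤ := fun i => z (i, 0) ^ 2 + 2 * z (i, 2) ^ 2 - 4 * z (i, 1) * z (i, 3) with hA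
  set B : Fin n → ℤ := fun i => 2 * z (i, 0) * z (i, 2) - z (i, 1) ^ 2 - 2 * z (i, 3) ^ 2 with hB
  set p : ℤ := ∑ i, (ε i * A i + 2 * η i * B i) with hp
  set q : ℤ := ∑ i, (ε i * B i + η i * A i) with hq
  have hD : ∀ i, dreal n i = ε i + η i * alpha ^ 2 := by
    intro i; simp only [dreal, hε, hη]; split_ifs <;> simp
  have hN : ∀ i, cx2 z i * cx1 z i = A i + B i * alpha ^ 2 := by
    intro i
    simp only [cx1, cx2, hA, hB]; push_cast
    linear_combination ((z (i, 2) : ℝ) ^ 2 - 2 * z (i, 1) * z (i, 3)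
      - z (i, 3) ^ 2 * alpha ^ 2) * hal
  have hN' : ∀ i, cx3 z i ^ 2 + cx4 z i ^ 2 = A i - B i * alpha ^ 2 := by
    intro i
    simp only [cx3, cx4, hA, hB]; push_cast
    linear_combination ((z (i, 2) : ℝ) ^ 2 - 2 * z (i, 1) * z (i, 3)
      + z (i, 3) ^ 2 * alpha ^ 2) * hal
  have e1 : (p : ℝ) + q * alpha ^ 2 = ∑ i, dreal n i * (g' *ᵥ cx2 z) i * (g *ᵥ cx1 z) i := by
    rw [form_invariant g g' hg, hp, hq]
    push_cast
    rw [Finset.sum_mul, ← Finset.sum_add_distrib]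
    refine Finset.sum_congr rfl fun i _ => ?_
    rw [mul_assoc (dreal n i), hN, hD]
    linear_combination (-(η i : ℝ) * B i) * hal
  have e2 : (p : ℝ) - q * alpha ^ 2
      = ∑ i, ((ε i : ℝ) - η i * alpha ^ 2) * (cx3 z i ^ 2 + cx4 z i ^ 2) := by
    rw [hp, hq]
    push_cast
    rw [Finset.sum_mul, ← Finset.sum_sub_distrib]
    refine Finset.sum_congr rfl fun i _ => ?_
    rw [hN']
    linear_combination (-(η i : ℝ) * B i) * hal
  have hD' : ∀ i, |((ε i : ℝ) - η i * alpha ^ 2)| ≤ 2 ∧ ((ε i : ℝ) - η i * alpha ^ 2) ≤ -1 := by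
    intro i
    simp only [hε, hη]
    split_ifs
    · simp
    · simp only [Int.cast_zero, Int.cast_one, one_mul, zero_sub, abs_neg]
      rw [abs_of_pos (by linarith)]
      exact ⟨hsq.le, by linarith⟩
  have b1 : |(p : ℝ) + q * alpha ^ 2| ≤ n * (2 * a * a) := by
    rw [e1]
    refine (Finset.abs_sum_le_sum_abs _ _).trans ?_
    refine (Finset.sum_le_card_nsmul _ _ (2 * a * a) fun i _ => ?_).trans (by simp)
    rw [abs_mul, abs_mul]
    have := dreal_abs n i
    have := h1 i
    have := h2 i
    gcongr
  have b2 : |(p : ℝ) - q * alpha ^ 2| ≤ n * (2 * (a ^ 2 + a ^ 2)) := by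
    rw [e2]
    refine (Finset.abs_sum_le_sum_abs _ _).trans ?_
    refine (Finset.sum_le_card_nsmul _ _ (2 * (a ^ 2 + a ^ 2)) fun i _ => ?_).trans (by simp)
    rw [abs_mul]
    have c1 := (hD' i).1
    have c2 : |cx3 z i ^ 2 + cx4 z i ^ 2| ≤ a ^ 2 + a ^ 2 := by
      rw [abs_of_nonneg (by positivity), ← sq_abs (cx3 z i), ← sq_abs (cx4 z i)]
      have := h3 i
      have := h4 i
      gcongr
    gcongr
  have hna : (n : ℝ) * a = 1 / 4 := by rw [ha]; field_simp
  have ha1 : a ≤ 1 := by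
    nlinarith
  have hlt : |((p : ℝ) + q * alpha ^ 2) * ((p : ℝ) - q * alpha ^ 2)| < 1 := by
    rw [abs_mul]
    calc _ ≤ (n * (2 * a * a)) * (n * (2 * (a ^ 2 + a ^ 2))) := by gcongr
      _ = 8 * (n * a) ^ 2 * a ^ 2 := by ring
      _ < 1 := by rw [hna]; nlinarith
  obtain ⟨hp0, hq0⟩ := int_norm_ge p q hlt
  rw [hp0, hq0] at e2
  have hz : ∀ i, cx3 z i ^ 2 + cx4 z i ^ 2 = 0 := by
    have hsum : ∑ i, (-((ε i : ℝ) - η i * alpha ^ 2)) * (cx3 z i ^ 2 + cx4 z i ^ 2) = 0 := by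
      simp only [neg_mul, Finset.sum_neg_distrib, ← e2]; simp
    rw [Finset.sum_eq_zero_iff_of_nonneg] at hsum
    · intro i
      have := hsum i (Finset.mem_univ _)
      rcases mul_eq_zero.mp this with h | h
      · linarith [(hD' i).2]
      · exact h
    · intro i _
      have := (hD' i).2
      exact mul_nonneg (by linarith) (by positivity)
  have key : ∀ u v : ℤ, (u : ℝ) - v * alpha ^ 2 = 0 → u = 0 ∧ v = 0 := by
    intro u v h
    apply int_norm_ge
    rw [h]; simp
  funext ⟨i, k⟩
  have hi := hz i
  have h30 : cx3 z i = 0 := by nlinarith [sq_nonneg (cx3 z i), sq_nonneg (cx4 z i)]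
  have h40 : cx4 z i = 0 := by nlinarith [sq_nonneg (cx3 z i), sq_nonneg (cx4 z i)]
  have k1 := key _ _ h30
  have k2 := key (z (i, 1)) (z (i, 3)) (by
    have : alpha * ((z (i, 1) : ℝ) - z (i, 3) * alpha ^ 2) = 0 := by
      rw [← h40]; simp only [cx4]; ring
    exact (mul_eq_zero.mp this).resolve_left alpha_pos.ne')
  fin_cases k
  · exact k1.1
  · exact k2.1
  · exact k1.2
  · exact k2.2

/-- The main consequence of Minkowski's theorem: uniformly bounded lattice points off a
hyperplane. -/
theorem exists_short {n : ℕ} (hn : 2 ≤ n) : ∃ B : ℝ, 0 < B ∧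
    ∀ g g' : Matrix (Fin n) (Fin n) ℝ, g.det = 1 → g'.det = 1 →
    g'ᵀ * Matrix.diagonal (dreal n) * g = Matrix.diagonal (dreal n) →
    ∀ c : Fin n → ℝ, c ≠ 0 → ∃ z : Fin n × Fin 4 → ℤ,
      c ⬝ᵥ cx1 z ≠ 0 ∧ (∀ i, |(g *ᵥ cx1 z) i| ≤ B) ∧ (∀ i, |(g' *ᵥ cx2 z) i| ≤ B) ∧
      (∀ i, |cx3 z i| ≤ B) ∧ (∀ i, |cx4 z i| ≤ B) := by
  classical
  have hn' : (2 : ℝ) ≤ n := by exact_mod_cast hn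
  set a : ℝ := 1 / (4 * n) with ha
  have hapos : 0 < a := by rw [ha]; positivity
  set P : Matrix (Fin n × Fin 4) (Fin n × Fin 4) ℝ :=
    Matrix.kroneckerMap (fun x y => x * y) (1 : Matrix (Fin n) (Fin n) ℝ) Vmat with hP
  have hPdet : P.det ≠ 0 := by
    rw [hP, Matrix.det_kronecker]
    simp [Vmat_det]
  set N := Fintype.card (Fin n × Fin 4) with hN
  set R : ℝ := |P.det| / a ^ N + 1 with hR
  have hR1 : 1 ≤ R := by
    have : 0 ≤ |P.det| / a ^ N := by positivity
    linarith
  have hRP : |P.det| / R < a ^ N := by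
    rw [div_lt_iff₀ (by linarith), hR, mul_add, mul_one, mul_div_cancel₀ _ (by positivity)]
    have : 0 < a ^ N := by positivity
    linarith
  refine ⟨a + R * (n * a), by positivity, ?_⟩
  have haB : a ≤ a + R * (n * a) := by
    have : 0 ≤ R * (n * a) := by positivity
    linarith
  intro g g' hg hg' hgg c hc
  set w : Fin n → ℝ := c ᵥ* g⁻¹ with hw
  have hgu : IsUnit g.det := by rw [hg]; exact isUnit_one
  have hwg : w ᵥ* g = c := by
    rw [hw, Matrix.vecMul_vecMul, Matrix.nonsing_inv_mul _ hgu, Matrix.vecMul_one]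
  have hw0 : w ≠ 0 := by
    intro h; rw [h] at hwg; simp at hwg; exact hc hwg.symm
  have hww : 0 < w ⬝ᵥ w := by
    have h0 : 0 ≤ w ⬝ᵥ w := Finset.sum_nonneg fun i _ => mul_self_nonneg _
    refine lt_of_le_of_ne h0 fun h => hw0 (dotProduct_self_eq_zero.mp h.symm)
  set r : ℝ := √(w ⬝ᵥ w) with hr
  have hrpos : 0 < r := Real.sqrt_pos.mpr hww
  have hrr : r * r = w ⬝ᵥ w := Real.mul_self_sqrt hww.le
  set u : Fin n → ℝ := r⁻¹ • w with hu
  have huu : u ⬝ᵥ u = 1 := by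
    rw [hu, smul_dotProduct, dotProduct_smul, ← hrr]
    simp only [smul_eq_mul]; field_simp
  have hui : ∀ i, |u i| ≤ 1 := by
    intro i
    rw [← sq_le_one_iff_abs_le_one, ← huu, sq]
    exact Finset.single_le_sum (f := fun i => u i * u i) (fun i _ => mul_self_nonneg _)
      (Finset.mem_univ i)
  set T : Matrix (Fin n) (Fin n) ℝ :=
    1 + Matrix.replicateCol Unit ((1 / R - 1) • u) * Matrix.replicateRow Unit u with hT
  have hTdet : T.det = 1 / R := by
    rw [hT, Matrix.det_one_add_replicateCol_mul_replicateRow, dotProduct_smul, huu]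
    simp
  have hTv : ∀ y i, (T *ᵥ y) i = y i + (1 / R - 1) * (u ⬝ᵥ y) * u i := by
    intro y i
    rw [hT, Matrix.add_mulVec, Matrix.one_mulVec, Pi.add_apply]
    congr 1
    simp only [Matrix.mulVec, dotProduct, Matrix.mul_apply, Matrix.replicateCol_apply,
      Matrix.replicateRow_apply, Pi.smul_apply, smul_eq_mul, Finset.univ_unique,
      Finset.sum_singleton]
    rw [Finset.mul_sum, Finset.sum_mul]
    exact Finset.sum_congr rfl fun j _ => by ring
  set Q : Matrix (Fin n × Fin 4) (Fin n × Fin 4) ℝ :=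
    Matrix.blockDiagonal (![T * g, g', 1, 1]) with hQ
  have hQdet : Q.det = 1 / R := by
    rw [hQ, Matrix.det_blockDiagonal]
    simp [Fin.prod_univ_succ, hTdet, hg, hg']
  have hdet : (Q * P).det = P.det / R := by
    rw [Matrix.det_mul, hQdet]; ring
  obtain ⟨z, hz0, hz⟩ := minkowski_forms (Q * P)
    (by rw [hdet]; exact div_ne_zero hPdet (by positivity)) a hapos
    (by rw [hdet, abs_div, abs_of_pos (show 0 < R by linarith)]; exact hRP)
  have hPz : ∀ i k, (P *ᵥ (fun j => (z j : ℝ))) (i, k) = ![cx1 z i, cx2 z i, cx3 z i, cx4 z i] k := by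
    intro i k
    simp only [hP, Matrix.mulVec, dotProduct, Fintype.sum_prod_type, Matrix.kroneckerMap_apply,
      Matrix.one_apply, ite_mul, one_mul, zero_mul]
    rw [Finset.sum_eq_single i (by
      intro j _ hj
      simp [hj.symm]) (by simp)]
    fin_cases k <;>
      simp [Fin.sum_univ_succ, Vmat, cx1, cx2, cx3, cx4] <;> ring
  have hQy : ∀ (y : Fin n × Fin 4 → ℝ) i k, (Q *ᵥ y) (i, k)
      = ((![T * g, g', 1, 1] : Fin 4 → Matrix (Fin n) (Fin n) ℝ) k *ᵥ fun j => y (j, k)) i := by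
    intro y i k
    simp only [hQ, Matrix.mulVec, dotProduct, Fintype.sum_prod_type, Matrix.blockDiagonal_apply,
      ite_mul, zero_mul]
    refine Finset.sum_congr rfl fun j _ => ?_
    simp
  have hfin : ∀ i k, |((![T * g, g', 1, 1] : Fin 4 → Matrix (Fin n) (Fin n) ℝ) k *ᵥ
      fun j => ![cx1 z j, cx2 z j, cx3 z j, cx4 z j] k) i| ≤ a := by
    intro i k
    have := hz (i, k)
    rw [← Matrix.mulVec_mulVec, hQy] at this
    simpa only [hPz] using this
  have f1 : ∀ i, |(T *ᵥ (g *ᵥ cx1 z)) i| ≤ a := by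
    intro i
    have := hfin i 0
    rw [Matrix.mulVec_mulVec]
    simpa using this
  have f2 : ∀ i, |(g' *ᵥ cx2 z) i| ≤ a := by
    intro i
    have := hfin i 1
    simpa using this
  have f3 : ∀ i, |cx3 z i| ≤ a := by
    intro i
    have := hfin i 2
    simpa using this
  have f4 : ∀ i, |cx4 z i| ≤ a := by
    intro i
    have := hfin i 3
    simpa using this
  have huc : u ⬝ᵥ (g *ᵥ cx1 z) = r⁻¹ * (c ⬝ᵥ cx1 z) := by
    rw [hu, smul_dotProduct, Matrix.dotProduct_mulVec, hwg, smul_eq_mul]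
  refine ⟨z, ?_, ?_, fun i => (f2 i).trans haB, fun i => (f3 i).trans haB,
    fun i => (f4 i).trans haB⟩
  · intro h0
    apply hz0
    refine no_small hn g g' hgg z a ha ?_ f2 f3 f4
    intro i
    have := f1 i
    rw [hTv, huc, h0] at this
    simpa using this
  · intro i
    set y := g *ᵥ cx1 z with hy
    set v := T *ᵥ y with hv
    have huv : u ⬝ᵥ v = (u ⬝ᵥ y) / R := by
      have : v = y + ((1 / R - 1) * (u ⬝ᵥ y)) • u := by
        funext j; rw [hv, hTv]; simp
      rw [this, dotProduct_add, dotProduct_smul, huu, smul_eq_mul]; ring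
    have hyi : y i = v i + (R - 1) * (u ⬝ᵥ v) * u i := by
      rw [huv, hv, hTv]
      field_simp
      ring
    have hub : |u ⬝ᵥ v| ≤ n * a := by
      refine (Finset.abs_sum_le_sum_abs _ _).trans ?_
      refine (Finset.sum_le_card_nsmul _ _ a fun j _ => ?_).trans (by simp)
      rw [abs_mul]
      calc _ ≤ 1 * a := by
            have := hui j
            have := f1 j
            gcongr
        _ = a := one_mul a
    rw [hyi]
    refine (abs_add_le _ _).trans ?_
    refine add_le_add (f1 i) ?_
    rw [abs_mul, abs_mul, abs_of_nonneg (by linarith : 0 ≤ R - 1)]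
    calc (R - 1) * |u ⬝ᵥ v| * |u i| ≤ R * (n * a) * 1 := by
          have := hui i
          have : R - 1 ≤ R := by linarith
          gcongr
      _ = R * (n * a) := mul_one _

/-! ### The number field `L` -/

theorem alpha_isIntegral : IsIntegral ℤ alpha := by
  refine ⟨(X ^ 4 - C 2 : ℤ[X]), monic_X_pow_sub_C 2 (by decide), ?_⟩
  rw [eval₂_sub, eval₂_X_pow, eval₂_C, alpha_pow_four]; simp

instance L_numberField : NumberField L where
  to_charZero := inferInstance
  to_finiteDimensional :=
    IntermediateField.adjoin.finiteDimensional (alpha_isIntegral.tower_top)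

/-- The inclusion of `L` into the reals. -/
noncomputable def iota : L →+* ℝ := algebraMap L ℝ

theorem iota_apply (x : L) : iota x = (x : ℝ) := rfl

theorem iota_alphaL : iota alphaL = alpha := rfl

theorem iota_injective : Function.Injective iota := iota.injective

theorem alphaL_pow_four : alphaL ^ 4 = 2 := by
  apply iota_injective
  rw [map_pow, iota_alphaL, alpha_pow_four]; exact (map_ofNat iota 2).symm

theorem alphaL_isIntegral : IsIntegral ℤ alphaL := by
  refine ⟨(X ^ 4 - C 2 : ℤ[X]), monic_X_pow_sub_C 2 (by decide), ?_⟩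
  rw [eval₂_sub, eval₂_X_pow, eval₂_C, alphaL_pow_four]; simp

theorem phi_ext {K : Type} [Field K] [Algebra ℚ K] (φ ψ : L →+* K)
    (h : φ alphaL = ψ alphaL) : φ = ψ := by
  have h1 : φ.toRatAlgHom = ψ.toRatAlgHom := by
    apply IntermediateField.algHom_ext_of_eq_adjoin ℚ (s := {alpha}) (S := L) rfl
    intro x hx
    rw [Set.mem_singleton_iff] at hx
    subst hx
    exact h
  ext x
  exact congrArg (fun f : L →ₐ[ℚ] K => f x) h1

theorem phi_cases (τ : L ≃ₐ[ℚ] L) (hτ : τ alphaL = -alphaL) (φ : L →+* ℂ) :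
    (∀ x, φ x = (iota x : ℂ)) ∨ (∀ x, φ x = (iota (τ x) : ℂ)) ∨
      (φ alphaL = Complex.I * alpha ∨ φ alphaL = -(Complex.I * alpha)) := by
  have h4 : (φ alphaL) ^ 4 = 2 := by rw [← map_pow, alphaL_pow_four]; exact map_ofNat φ 2
  have ha4 : (alpha : ℂ) ^ 4 = 2 := by exact_mod_cast alpha_pow_four
  have hfac : (φ alphaL - alpha) * ((φ alphaL + alpha) *
      ((φ alphaL - Complex.I * alpha) * (φ alphaL + Complex.I * alpha))) = 0 := by
    have : (φ alphaL - alpha) * ((φ alphaL + alpha) *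
      ((φ alphaL - Complex.I * alpha) * (φ alphaL + Complex.I * alpha)))
      = φ alphaL ^ 4 - (alpha : ℂ) ^ 4 := by
      linear_combination ((alpha : ℂ) ^ 4 - φ alphaL ^ 2 * (alpha : ℂ) ^ 2) * Complex.I_sq
    rw [this, h4, ha4, sub_self]
  rcases mul_eq_zero.mp hfac with h | h
  · left
    have : φ = (algebraMap ℝ ℂ).comp iota := phi_ext _ _ (by
      rw [sub_eq_zero.mp h]; rfl)
    intro x; rw [this]; rfl
  rcases mul_eq_zero.mp h with h | h
  · right; left
    have : φ = ((algebraMap ℝ ℂ).comp iota).comp (τ : L →+* L) := phi_ext _ _ (by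
      rw [eq_neg_of_add_eq_zero_left h]
      simp [hτ, iota_alphaL])
    intro x; rw [this]; rfl
  rcases mul_eq_zero.mp h with h | h
  · right; right; left; exact sub_eq_zero.mp h
  · right; right; right; exact eq_neg_of_add_eq_zero_left h

theorem tau_tau (τ : L ≃ₐ[ℚ] L) (hτ : τ alphaL = -alphaL) (x : L) : τ (τ x) = x := by
  have : ((τ : L →+* L).comp (τ : L →+* L)) = RingHom.id L := phi_ext _ _ (by simp [hτ])
  exact congrArg (fun f : L →+* L => f x) this

theorem phi_tau (τ : L ≃ₐ[ℚ] L) (hτ : τ alphaL = -alphaL) (φ : L →+* ℂ)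
    (h : φ alphaL = Complex.I * alpha ∨ φ alphaL = -(Complex.I * alpha)) (x : L) :
    φ (τ x) = (starRingEnd ℂ) (φ x) := by
  have : φ.comp (τ : L →+* L) = (starRingEnd ℂ).comp φ := phi_ext _ _ (by
    rcases h with h | h <;> simp [hτ, h])
  exact congrArg (fun f : L →+* ℂ => f x) this

theorem phi_sq (φ : L →+* ℂ)
    (h : φ alphaL = Complex.I * alpha ∨ φ alphaL = -(Complex.I * alpha)) :
    φ alphaL ^ 2 = -(alpha : ℂ) ^ 2 := by
  rcases h with h | h <;> rw [h] <;> linear_combination ((alpha : ℂ) ^ 2) * Complex.I_sq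

/-- The entries of `D_n` in `L`. -/
noncomputable def dL (n : ℕ) (i : Fin n) : L := if (i : ℕ) = 0 then -1 else alphaL ^ 2

theorem Dmat_eq (n : ℕ) : Dmat n = Matrix.diagonal (dL n) := rfl

theorem iota_dL (n : ℕ) (i : Fin n) : iota (dL n i) = dreal n i := by
  unfold dL dreal
  split_ifs <;> simp [iota_alphaL]

theorem tau_dL (τ : L ≃ₐ[ℚ] L) (hτ : τ alphaL = -alphaL) (n : ℕ) (i : Fin n) :
    τ (dL n i) = dL n i := by
  unfold dL
  split_ifs <;> simp [hτ]

theorem dL_isIntegral (n : ℕ) (i : Fin n) : IsIntegral ℤ (dL n i) := by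
  unfold dL
  split_ifs
  · exact isIntegral_one.neg
  · exact alphaL_isIntegral.pow 2

theorem phi_dL (φ : L →+* ℂ)
    (h : φ alphaL = Complex.I * alpha ∨ φ alphaL = -(Complex.I * alpha)) (n : ℕ) (i : Fin n) :
    ∃ t : ℝ, φ (dL n i) = -(t : ℂ) ∧ 1 ≤ t ∧ t ≤ 2 := by
  unfold dL
  split_ifs
  · exact ⟨1, by simp, le_refl _, by norm_num⟩
  · refine ⟨alpha ^ 2, ?_, one_lt_alpha_sq.le, alpha_sq_lt.le⟩
    rw [map_pow, phi_sq φ h]; simp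

/-- The hermitian Gram matrix. -/
noncomputable def Hm {n : ℕ} (τ : L ≃ₐ[ℚ] L) (X : Matrix (Fin n) (Fin n) L) :
    Matrix (Fin n) (Fin n) L := (X.transpose.map τ) * Dmat n * X

theorem Hm_apply {n : ℕ} (τ : L ≃ₐ[ℚ] L) (X : Matrix (Fin n) (Fin n) L) (i j : Fin n) :
    Hm τ X i j = ∑ k, dL n k * τ (X k i) * X k j := by
  rw [Hm, Dmat_eq, Matrix.mul_apply]
  refine Finset.sum_congr rfl fun k _ => ?_
  rw [Matrix.mul_diagonal]
  simp only [Matrix.map_apply, Matrix.transpose_apply]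
  ring

theorem map_tau_mul {n : ℕ} (τ : L ≃ₐ[ℚ] L) (X Y : Matrix (Fin n) (Fin n) L) :
    (X * Y).map τ = X.map τ * Y.map τ := by
  ext i j
  simp [Matrix.mul_apply]

theorem Hm_mul {n : ℕ} (τ : L ≃ₐ[ℚ] L) (X Y : Matrix (Fin n) (Fin n) L) :
    Hm τ (X * Y) = (Y.transpose.map τ) * Hm τ X * Y := by
  simp only [Hm, Matrix.transpose_mul, map_tau_mul, Matrix.mul_assoc]

/-- The vector of `ℤ[α]ⁿ` with given coordinates. -/
noncomputable def ev {n : ℕ} (z : Fin n × Fin 4 → ℤ) (i : Fin n) : L :=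
  z (i, 0) + z (i, 1) * alphaL + z (i, 2) * alphaL ^ 2 + z (i, 3) * alphaL ^ 3

theorem isIntegral_intCast' (m : ℤ) : IsIntegral ℤ (m : L) := by
  simpa using (isIntegral_algebraMap (R := ℤ) (A := L) (x := m))

theorem ev_isIntegral {n : ℕ} (z : Fin n × Fin 4 → ℤ) (i : Fin n) : IsIntegral ℤ (ev z i) := by
  unfold ev
  have h := alphaL_isIntegral
  exact (((isIntegral_intCast' _).add ((isIntegral_intCast' _).mul h)).add
    ((isIntegral_intCast' _).mul (h.pow 2))).add ((isIntegral_intCast' _).mul (h.pow 3))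

theorem iota_ev {n : ℕ} (z : Fin n × Fin 4 → ℤ) (i : Fin n) : iota (ev z i) = cx1 z i := by
  simp [ev, cx1, iota_alphaL]

theorem iota_tau_ev {n : ℕ} (τ : L ≃ₐ[ℚ] L) (hτ : τ alphaL = -alphaL)
    (z : Fin n × Fin 4 → ℤ) (i : Fin n) : iota (τ (ev z i)) = cx2 z i := by
  simp [ev, cx2, iota_alphaL, hτ]
  ring

theorem phi_ev {n : ℕ} (φ : L →+* ℂ)
    (h : φ alphaL = Complex.I * alpha ∨ φ alphaL = -(Complex.I * alpha))
    (z : Fin n × Fin 4 → ℤ) (i : Fin n) (B : ℝ) (h3 : |cx3 z i| ≤ B) (h4 : |cx4 z i| ≤ B) :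
    ‖φ (ev z i)‖ ≤ 2 * B := by
  have h2 := phi_sq φ h
  have hcube : φ alphaL ^ 3 = -(alpha : ℂ) ^ 2 * φ alphaL := by rw [← h2]; ring
  have e : φ (ev z i) = (cx3 z i : ℂ) + (φ alphaL / alpha) * (cx4 z i : ℂ) := by
    have h0 : (alpha : ℂ) ≠ 0 := by exact_mod_cast alpha_pos.ne'
    simp only [ev, map_add, map_mul, map_intCast, map_pow, h2, hcube, cx3, cx4]
    push_cast
    field_simp
    ring
  have hn : ‖φ alphaL / alpha‖ = 1 := by
    have h0 : (alpha : ℂ) ≠ 0 := by exact_mod_cast alpha_pos.ne'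
    rcases h with h | h <;> rw [h] <;> simp [abs_of_pos alpha_pos, alpha_pos.ne']
  rw [e]
  refine (norm_add_le _ _).trans ?_
  rw [norm_mul, hn, one_mul, Complex.norm_real, Complex.norm_real, Real.norm_eq_abs,
    Real.norm_eq_abs]
  linarith

/-- `n` independent vectors with uniformly bounded coordinates. -/
theorem exists_X {n : ℕ} (hn : 2 ≤ n) (τ : L ≃ₐ[ℚ] L) (hτ : τ alphaL = -alphaL) :
    ∃ B : ℝ, 0 < B ∧
    ∀ g g' : Matrix (Fin n) (Fin n) ℝ, g.det = 1 → g'.det = 1 →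
    g'ᵀ * Matrix.diagonal (dreal n) * g = Matrix.diagonal (dreal n) →
    ∃ X : Matrix (Fin n) (Fin n) L, (∀ i j, IsIntegral ℤ (X i j)) ∧ X.det ≠ 0 ∧
      (∀ i j, |(g * X.map iota) i j| ≤ B) ∧
      (∀ i j, |(g' * (X.map τ).map iota) i j| ≤ B) ∧
      (∀ φ : L →+* ℂ, (φ alphaL = Complex.I * alpha ∨ φ alphaL = -(Complex.I * alpha)) →
        ∀ i j, ‖φ (X i j)‖ ≤ B) := by
  classical
  obtain ⟨B, hB, hshort⟩ := exists_short hn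
  refine ⟨2 * B, by positivity, ?_⟩
  intro g g' hg hg' hgg
  set S : Set (Fin n → L) := {x | ∃ z : Fin n × Fin 4 → ℤ, x = ev z ∧
      (∀ i, |(g *ᵥ cx1 z) i| ≤ B) ∧ (∀ i, |(g' *ᵥ cx2 z) i| ≤ B) ∧
      (∀ i, |cx3 z i| ≤ B) ∧ (∀ i, |cx4 z i| ≤ B)} with hS
  have hspan : Submodule.span L S = ⊤ := by
    by_contra hne
    obtain ⟨f, hf0, hf⟩ := Submodule.exists_le_ker_of_lt_top _ (lt_top_iff_ne_top.mpr hne)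
    set c : Fin n → ℝ := fun i => iota (f (Pi.single i 1)) with hc
    have hfx : ∀ x : Fin n → L, iota (f x) = ∑ i, c i * iota (x i) := by
      intro x
      conv_lhs => rw [LinearMap.pi_apply_eq_sum_univ f x]
      rw [map_sum]
      refine Finset.sum_congr rfl fun i _ => ?_
      rw [smul_eq_mul, map_mul, mul_comm]
      congr 3
      funext j
      simp [Pi.single_apply, eq_comm]
    have hc0 : c ≠ 0 := by
      intro h
      apply hf0
      refine LinearMap.ext fun x => ?_
      apply iota_injective
      rw [hfx]
      simp [h]
    obtain ⟨z, hz0, hz⟩ := hshort g g' hg hg' hgg c hc0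
    have hmem : ev z ∈ S := ⟨z, rfl, hz⟩
    have h0 : f (ev z) = 0 := hf (Submodule.subset_span hmem)
    apply hz0
    have := hfx (ev z)
    rw [h0, map_zero] at this
    simp only [iota_ev] at this
    exact this.symm
  obtain ⟨b, hbS, hbspan, hbli⟩ := exists_linearIndependent L S
  have hbasis : ⊤ ≤ Submodule.span L (Set.range (Subtype.val : b → (Fin n → L))) := by
    rw [Subtype.range_coe, hbspan, hspan]
  set bb : Module.Basis b L (Fin n → L) := Module.Basis.mk hbli hbasis with hbb
  have hfinb : Fintype b := FiniteDimensional.fintypeBasisIndex bb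
  have hcard : Fintype.card b = Fintype.card (Fin n) := by
    rw [← Module.finrank_eq_card_basis bb]; simp
  have e : Fin n ≃ b := (Fintype.equivOfCardEq hcard).symm
  have hli : LinearIndependent L (fun j : Fin n => ((e j : b) : Fin n → L)) :=
    hbli.comp e e.injective
  have hex : ∀ j : Fin n, ((e j : b) : Fin n → L) ∈ S := fun j => hbS (e j).2
  choose z hz hz1 hz2 hz3 hz4 using hex
  refine ⟨Matrix.of fun i j => ev (z j) i, ?_, ?_, ?_, ?_, ?_⟩
  · intro i j; exact ev_isIntegral _ _
  · have : IsUnit (Matrix.of fun i j => ev (z j) i) := by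
      rw [← Matrix.linearIndependent_cols_iff_isUnit]
      convert hli using 1
      funext j
      rw [hz j]; rfl
    rw [Matrix.isUnit_iff_isUnit_det] at this
    exact this.ne_zero
  · intro i j
    refine le_trans (le_of_eq ?_) ((hz1 j i).trans (by linarith))
    simp only [Matrix.mul_apply, Matrix.map_apply, Matrix.of_apply, iota_ev, Matrix.mulVec,
      dotProduct]
  · intro i j
    refine le_trans (le_of_eq ?_) ((hz2 j i).trans (by linarith))
    simp only [Matrix.mul_apply, Matrix.map_apply, Matrix.of_apply, iota_tau_ev τ hτ,
      Matrix.mulVec, dotProduct]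
  · intro φ hφ i j
    exact phi_ev φ hφ _ _ B (hz3 j i) (hz4 j i)

theorem tau_Hm {n : ℕ} (τ : L ≃ₐ[ℚ] L) (hτ : τ alphaL = -alphaL)
    (X : Matrix (Fin n) (Fin n) L) (i j : Fin n) : τ (Hm τ X i j) = Hm τ X j i := by
  rw [Hm_apply, Hm_apply, map_sum]
  refine Finset.sum_congr rfl fun k _ => ?_
  rw [map_mul, map_mul, tau_dL τ hτ, tau_tau τ hτ]
  ring

theorem gram_bound {n : ℕ} (τ : L ≃ₐ[ℚ] L) (hτ : τ alphaL = -alphaL) (B : ℝ) (hB : 0 < B)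
    (g g' : Matrix (Fin n) (Fin n) ℝ)
    (hgg : g'ᵀ * Matrix.diagonal (dreal n) * g = Matrix.diagonal (dreal n))
    (X : Matrix (Fin n) (Fin n) L)
    (h1 : ∀ i j, |(g * X.map iota) i j| ≤ B)
    (h2 : ∀ i j, |(g' * (X.map τ).map iota) i j| ≤ B)
    (h3 : ∀ φ : L →+* ℂ, (φ alphaL = Complex.I * alpha ∨ φ alphaL = -(Complex.I * alpha)) →
        ∀ i j, ‖φ (X i j)‖ ≤ B) (φ : L →+* ℂ) (i j : Fin n) :
    ‖φ (Hm τ X i j)‖ ≤ n * (2 * B * B) := by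
  have key : ∀ i j, |iota (Hm τ X i j)| ≤ n * (2 * B * B) := by
    intro i j
    have e : iota (Hm τ X i j)
        = ∑ k, dreal n k * (g' * (X.map τ).map iota) k i * (g * X.map iota) k j := by
      have := form_invariant g g' hgg (fun k => iota (X k j)) (fun k => iota (τ (X k i)))
      rw [Hm_apply, map_sum]
      simp only [map_mul, iota_dL]
      rw [← this]
      rfl
    rw [e]
    refine (Finset.abs_sum_le_sum_abs _ _).trans ?_
    refine (Finset.sum_le_card_nsmul _ _ (2 * B * B) fun k _ => ?_).trans (by simp)
    rw [abs_mul, abs_mul]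
    have := dreal_abs n k
    have := h1 k j
    have := h2 k i
    gcongr
  rcases phi_cases τ hτ φ with h | h | h
  · rw [h, Complex.norm_real]; exact key i j
  · rw [h, Complex.norm_real, tau_Hm τ hτ]; exact key j i
  · rw [Hm_apply, map_sum]
    refine (norm_sum_le _ _).trans ?_
    refine (Finset.sum_le_card_nsmul _ _ (2 * B * B) fun k _ => ?_).trans (by simp)
    rw [map_mul, map_mul, norm_mul, norm_mul, phi_tau τ hτ φ h, RCLike.norm_conj]
    obtain ⟨t, ht, ht1, ht2⟩ := phi_dL φ h n k
    have hd : ‖φ (dL n k)‖ ≤ 2 := by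
      rw [ht, norm_neg, Complex.norm_real, Real.norm_eq_abs, abs_of_nonneg (by linarith)]
      exact ht2
    have := h3 φ h k i
    have := h3 φ h k j
    gcongr

theorem det_bound {n : ℕ} (τ : L ≃ₐ[ℚ] L) (hτ : τ alphaL = -alphaL) (B : ℝ)
    (g g' : Matrix (Fin n) (Fin n) ℝ) (hg : g.det = 1) (hg' : g'.det = 1)
    (X : Matrix (Fin n) (Fin n) L)
    (h1 : ∀ i j, |(g * X.map iota) i j| ≤ B)
    (h2 : ∀ i j, |(g' * (X.map τ).map iota) i j| ≤ B)
    (h3 : ∀ φ : L →+* ℂ, (φ alphaL = Complex.I * alpha ∨ φ alphaL = -(Complex.I * alpha)) →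
        ∀ i j, ‖φ (X i j)‖ ≤ B) (φ : L →+* ℂ) :
    ‖φ X.det‖ ≤ (Fintype.card (Fin n)).factorial • B ^ (Fintype.card (Fin n)) := by
  rcases phi_cases τ hτ φ with h | h | h
  · have e : iota X.det = (g * X.map iota).det := by
      rw [Matrix.det_mul, hg, one_mul, RingHom.map_det]; rfl
    rw [h, Complex.norm_real, e]
    exact Matrix.det_le (abv := (AbsoluteValue.abs : AbsoluteValue ℝ ℝ)) h1
  · have e : iota (τ X.det) = (g' * (X.map τ).map iota).det := by
      rw [Matrix.det_mul, hg', one_mul, AlgEquiv.map_det, RingHom.map_det]; rfl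
    rw [h, Complex.norm_real, e]
    exact Matrix.det_le (abv := (AbsoluteValue.abs : AbsoluteValue ℝ ℝ)) h2
  · rw [RingHom.map_det]
    exact Matrix.det_le (abv := (NormedField.toAbsoluteValue ℂ : AbsoluteValue ℂ ℝ))
      (h3 φ h)

/-- Elements of `L` that are integral with bounded conjugates. -/
def bddSet (B : ℝ) : Set L := {x : L | IsIntegral ℤ x ∧ ∀ φ : L →+* ℂ, ‖φ x‖ ≤ B}

theorem bddSet_finite (B : ℝ) : (bddSet B).Finite :=
  NumberField.Embeddings.finite_of_norm_le L ℂ B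

theorem bddMat_finite {n : ℕ} (B : ℝ) :
    {M : Matrix (Fin n) (Fin n) L | ∀ i j, M i j ∈ bddSet B}.Finite :=
  Set.Finite.pi' fun _ => Set.Finite.pi' fun _ => bddSet_finite B

theorem Hm_isIntegral {n : ℕ} (τ : L ≃ₐ[ℚ] L) (X : Matrix (Fin n) (Fin n) L)
    (hX : ∀ i j, IsIntegral ℤ (X i j)) (i j : Fin n) : IsIntegral ℤ (Hm τ X i j) := by
  rw [Hm_apply]
  refine IsIntegral.sum _ fun k _ => ?_
  refine ((dL_isIntegral n k).mul ?_).mul (hX k j)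
  exact (hX k i).map ((τ : L →+* L).toIntAlgHom)

theorem det_map_tau {n : ℕ} (τ : L ≃ₐ[ℚ] L) (X : Matrix (Fin n) (Fin n) L) :
    (X.transpose.map τ).det = τ X.det := by
  rw [← Matrix.det_transpose X, AlgEquiv.map_det]; rfl

open NumberField in
/-- Finiteness of the number of classes modulo `Γ`. -/
theorem finite_classes {n : ℕ} (τ : L ≃ₐ[ℚ] L) (FH : Set (Matrix (Fin n) (Fin n) L))
    (hFH : FH.Finite) (Fd : Set L) (hFd : Fd.Finite) :
    ∃ T : Set (Matrix (Fin n) (Fin n) L), T.Finite ∧ (∀ Y ∈ T, Y.det ≠ 0) ∧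
      ∀ X : Matrix (Fin n) (Fin n) L, (∀ i j, IsIntegral ℤ (X i j)) → X.det ≠ 0 →
        Hm τ X ∈ FH → X.det ∈ Fd → ∃ Y ∈ T, ∃ γ : Matrix (Fin n) (Fin n) L,
          (∀ i j, IsIntegral ℤ (γ i j)) ∧ γ.det = 1 ∧ Hm τ γ = Dmat n ∧ X = γ * Y := by
  classical
  set κ : 𝓞 L →+* L := algebraMap (𝓞 L) L with hκ
  have κinj : Function.Injective κ := RingOfIntegers.coe_injective
  have hGfin : (κ ⁻¹' Fd).Finite := hFd.preimage κinj.injOn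
  set F : Finset (𝓞 L) := hGfin.toFinset.filter (· ≠ 0) with hF
  set m : 𝓞 L := ∏ d ∈ F, d with hm
  have hm0 : m ≠ 0 := by
    rw [hm, Finset.prod_ne_zero_iff]
    intro d hd
    exact (Finset.mem_filter.mp hd).2
  set I : Ideal (𝓞 L) := Ideal.span {m} with hI
  have hI0 : I ≠ ⊥ := by
    rw [hI, Ne, Ideal.span_singleton_eq_bot]; exact hm0
  have : Finite (𝓞 L ⧸ I) := Ideal.finiteQuotientOfFreeOfNeBot I hI0
  set 𝒳 : Set (Matrix (Fin n) (Fin n) (𝓞 L)) :=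
    {X | X.det ≠ 0 ∧ Hm τ (X.map κ) ∈ FH ∧ κ X.det ∈ Fd} with h𝒳
  set key : Matrix (Fin n) (Fin n) (𝓞 L) →
      Matrix (Fin n) (Fin n) L × (L × (Fin n → Fin n → 𝓞 L ⧸ I)) :=
    fun X => (Hm τ (X.map κ), κ X.det, fun i j => Ideal.Quotient.mk I (X i j)) with hkey
  have hkfin : (key '' 𝒳).Finite := by
    refine (hFH.prod (hFd.prod (Set.toFinite Set.univ))).subset ?_
    rintro _ ⟨X, hX, rfl⟩
    exact ⟨hX.2.1, hX.2.2, Set.mem_univ _⟩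
  obtain ⟨T, hT𝒳, hTfin, hTimg⟩ : ∃ T, T ⊆ 𝒳 ∧ T.Finite ∧ key '' T = key '' 𝒳 := by
    obtain ⟨T, h1, h2⟩ := Set.exists_subset_bijOn 𝒳 key
    refine ⟨T, h1, ?_, h2.image_eq⟩
    apply Set.Finite.of_finite_image _ h2.injOn
    rw [h2.image_eq]; exact hkfin
  have hdetκ : ∀ X : Matrix (Fin n) (Fin n) (𝓞 L), (X.map κ).det = κ X.det := by
    intro X; rw [RingHom.map_det]; rfl
  refine ⟨(fun X : Matrix (Fin n) (Fin n) (𝓞 L) => X.map κ) '' T, hTfin.image _, ?_, ?_⟩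
  · rintro _ ⟨Y, hY, rfl⟩
    change (Y.map κ).det ≠ 0
    rw [hdetκ]
    exact (map_ne_zero_iff κ κinj).mpr (hT𝒳 hY).1
  · intro X0 hX0 hdet hH hd
    set X : Matrix (Fin n) (Fin n) (𝓞 L) := Matrix.of fun i j => ⟨X0 i j, hX0 i j⟩ with hX
    have hXX : X.map κ = X0 := by ext i j; rfl
    have hXmem : X ∈ 𝒳 := by
      refine ⟨?_, ?_, ?_⟩
      · intro h
        apply hdet
        rw [← hXX, hdetκ, h, map_zero]
      · rw [hXX]; exact hH
      · rw [← hdetκ, hXX]; exact hd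
    obtain ⟨Y, hYT, hYX⟩ : key X ∈ key '' T := by
      rw [hTimg]; exact ⟨X, hXmem, rfl⟩
    have hY := hT𝒳 hYT
    simp only [hkey, Prod.mk.injEq] at hYX
    obtain ⟨k1, k2, k3⟩ := hYX
    have k2' : Y.det = X.det := κinj k2
    have hZ : ∀ i j, ∃ w, X i j - Y i j = m * w := by
      intro i j
      have := congrFun (congrFun k3 i) j
      rw [eq_comm, Ideal.Quotient.eq, hI, Ideal.mem_span_singleton] at this
      exact this
    choose Z hZ using hZ
    have hdm : Y.det ∣ m := by
      apply Finset.dvd_prod_of_mem (fun d : 𝓞 L => d)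
      rw [hF, Finset.mem_filter]
      refine ⟨?_, hY.1⟩
      rw [Set.Finite.mem_toFinset]
      exact hY.2.2
    obtain ⟨k, hk⟩ := hdm
    set γ : Matrix (Fin n) (Fin n) (𝓞 L) := 1 + k • (Matrix.of Z * Y.adjugate) with hγ
    have hγY : γ * Y = X := by
      rw [hγ, Matrix.add_mul, Matrix.one_mul, Matrix.smul_mul, Matrix.mul_assoc,
        Matrix.adjugate_mul, Matrix.mul_smul, Matrix.mul_one, smul_smul, mul_comm k, ← hk]
      ext1 i j
      simp only [Matrix.add_apply, Matrix.smul_apply, smul_eq_mul, Matrix.of_apply]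
      rw [← hZ]; ring
    have hγdet : γ.det = 1 := by
      have := congrArg Matrix.det hγY
      rw [Matrix.det_mul, ← k2'] at this
      exact mul_right_cancel₀ hY.1 (by rw [this, one_mul])
    have hmap : X0 = γ.map κ * Y.map κ := by
      rw [← hXX, ← hγY]
      exact Matrix.map_mul
    refine ⟨Y.map κ, ⟨Y, hYT, rfl⟩, γ.map κ, ?_, ?_, ?_, hmap⟩
    · intro i j; exact (γ i j).2
    · rw [hdetκ, hγdet, map_one]
    · have hYd : IsUnit (Y.map κ).det := by
        rw [hdetκ]; exact ((map_ne_zero_iff κ κinj).mpr hY.1).isUnit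
      have hYu : IsUnit (Y.map κ) := (Matrix.isUnit_iff_isUnit_det _).mpr hYd
      have hYtu : IsUnit ((Y.map κ).transpose.map τ) := by
        rw [Matrix.isUnit_iff_isUnit_det, det_map_tau]
        exact hYd.map τ
      have e : (Y.map κ).transpose.map τ * Hm τ (γ.map κ) * Y.map κ
          = (Y.map κ).transpose.map τ * Dmat n * Y.map κ := by
        rw [← Hm_mul, ← hmap, ← hXX, ← k1]; rfl
      exact hYtu.mul_left_cancel (hYu.mul_right_cancel e)

theorem dreal_ge (n : ℕ) (i : Fin n) : 1 ≤ |dreal n i| := by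
  unfold dreal
  split_ifs
  · norm_num
  · rw [abs_of_nonneg (by positivity)]; exact one_lt_alpha_sq.le

/-- The defining conditions of `Γ_n`. -/
def InG {n : ℕ} (τ : L ≃ₐ[ℚ] L) (h : Matrix (Fin n) (Fin n) L) : Prop :=
  (∀ i j, IsIntegral ℤ (h i j)) ∧ h.det = 1 ∧ Hm τ h = Dmat n

theorem cocompact_bound {n : ℕ} (hn : 2 ≤ n) (τ : L ≃ₐ[ℚ] L) (hτ : τ alphaL = -alphaL) :
    ∃ C : ℝ, ∀ g : Matrix (Fin n) (Fin n) ℝ, g.det = 1 →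
      ∃ γ : Matrix (Fin n) (Fin n) L, InG τ γ ∧ ∀ i j, |(g * γ.map iota) i j| ≤ C := by
  classical
  obtain ⟨B, hB, hX⟩ := exists_X hn τ hτ
  obtain ⟨T, hT, hTdet, hTX⟩ := finite_classes (n := n) τ
    {M | ∀ i j, M i j ∈ bddSet (n * (2 * B * B))} (bddMat_finite _)
    (bddSet ((Fintype.card (Fin n)).factorial • B ^ (Fintype.card (Fin n)))) (bddSet_finite _)
  obtain ⟨A, hA⟩ := (hT.image (fun Y => ∑ i, ∑ j, |(Y.map iota)⁻¹ i j|)).bddAbove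
  refine ⟨n * (B * A), ?_⟩
  intro g hg
  have hgu : IsUnit g.det := by rw [hg]; exact isUnit_one
  set D : Matrix (Fin n) (Fin n) ℝ := Matrix.diagonal (dreal n) with hD
  have hDdet : IsUnit D.det := by
    rw [hD, Matrix.det_diagonal, isUnit_iff_ne_zero, Finset.prod_ne_zero_iff]
    intro i _ h
    have := dreal_ge n i
    rw [h] at this
    norm_num at this
  set g' : Matrix (Fin n) (Fin n) ℝ := (D * g⁻¹ * D⁻¹)ᵀ with hg'
  have hg'det : g'.det = 1 := by
    rw [hg', Matrix.det_transpose, Matrix.det_mul, Matrix.det_mul, mul_right_comm,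
      ← Matrix.det_mul, Matrix.mul_nonsing_inv _ hDdet, Matrix.det_one, one_mul,
      Matrix.det_nonsing_inv, hg]
    simp
  have hgg : g'ᵀ * D * g = D := by
    rw [hg', Matrix.transpose_transpose, Matrix.mul_assoc (D * g⁻¹),
      Matrix.nonsing_inv_mul _ hDdet, Matrix.mul_one, Matrix.mul_assoc,
      Matrix.nonsing_inv_mul _ hgu, Matrix.mul_one]
  obtain ⟨X, hXint, hXdet, x1, x2, x3⟩ := hX g g' hg hg'det hgg
  obtain ⟨Y, hYT, γ, hγint, hγdet, hγH, hXY⟩ := hTX X hXint hXdet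
    (fun i j => ⟨Hm_isIntegral τ X hXint i j, fun φ =>
      gram_bound τ hτ B hB g g' hgg X x1 x2 x3 φ i j⟩)
    ⟨IsIntegral.det hXint, fun φ => det_bound τ hτ B g g' hg hg'det X x1 x2 x3 φ⟩
  refine ⟨γ, ⟨hγint, hγdet, hγH⟩, ?_⟩
  have hYdet : IsUnit (Y.map iota).det := by
    have : (Y.map iota).det = iota Y.det := by rw [RingHom.map_det]; rfl
    rw [this]
    exact ((map_ne_zero_iff iota iota_injective).mpr (hTdet Y hYT)).isUnit
  have e : g * γ.map iota = (g * X.map iota) * (Y.map iota)⁻¹ := by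
    have : X.map iota = γ.map iota * Y.map iota := by rw [hXY]; exact Matrix.map_mul
    rw [this, Matrix.mul_assoc, Matrix.mul_assoc, Matrix.mul_nonsing_inv _ hYdet, Matrix.mul_one]
  have hYA : ∀ i j, |(Y.map iota)⁻¹ i j| ≤ A := by
    intro i j
    have h0 : ∑ i, ∑ j, |(Y.map iota)⁻¹ i j| ≤ A := hA ⟨Y, hYT, rfl⟩
    refine le_trans ?_ h0
    refine le_trans ?_ (Finset.single_le_sum (f := fun i => ∑ j, |(Y.map iota)⁻¹ i j|)
      (fun i _ => Finset.sum_nonneg fun j _ => abs_nonneg _) (Finset.mem_univ i))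
    exact Finset.single_le_sum (f := fun j => |(Y.map iota)⁻¹ i j|)
      (fun j _ => abs_nonneg _) (Finset.mem_univ j)
  intro i j
  rw [e, Matrix.mul_apply]
  refine (Finset.abs_sum_le_sum_abs _ _).trans ?_
  refine (Finset.sum_le_card_nsmul _ _ (B * A) fun k _ => ?_).trans (by simp)
  rw [abs_mul]
  have := x1 i k
  have := hYA k j
  gcongr

theorem discrete_finite {n : ℕ} (τ : L ≃ₐ[ℚ] L) (hτ : τ alphaL = -alphaL) (C : ℝ) :
    {h : Matrix (Fin n) (Fin n) L | InG τ h ∧ (∀ i j, |iota (h i j)| ≤ C) ∧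
      ∀ i j, |iota (h.adjugate i j)| ≤ C}.Finite := by
  refine (bddMat_finite (2 * |C| + 2)).subset ?_
  rintro h ⟨⟨hint, hdet, hH⟩, hC1, hC2⟩ i j
  refine ⟨hint i j, fun φ => ?_⟩
  have hCC := le_abs_self C
  have hC0 := abs_nonneg C
  rcases phi_cases τ hτ φ with hφ | hφ | hφ
  · rw [hφ, Complex.norm_real]
    exact (hC1 i j).trans (by linarith)
  · rw [hφ, Complex.norm_real, Real.norm_eq_abs]
    have e : h.transpose.map τ * Dmat n = Dmat n * h.adjugate := by
      have h1 : h * h.adjugate = 1 := by rw [Matrix.mul_adjugate, hdet, one_smul]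
      rw [← hH, Hm, Matrix.mul_assoc (_ * _), h1, Matrix.mul_one]
      rw [← Hm, hH]
    have e2 := congrArg iota (congrFun (congrFun e j) i)
    rw [Dmat_eq, Matrix.mul_diagonal, Matrix.diagonal_mul] at e2
    simp only [Matrix.map_apply, Matrix.transpose_apply, map_mul, iota_dL] at e2
    have e3 := congrArg abs e2
    rw [abs_mul, abs_mul] at e3
    have d1 := dreal_ge n i
    have d2 := dreal_abs n j
    have a1 := hC2 j i
    have : |iota (τ (h i j))| ≤ |iota (τ (h i j))| * |dreal n i| :=
      le_mul_of_one_le_right (abs_nonneg _) d1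
    have : |dreal n j| * |iota (h.adjugate j i)| ≤ 2 * |C| :=
      mul_le_mul d2 (a1.trans hCC) (abs_nonneg _) (by norm_num)
    linarith
  · choose t ht ht1 ht2 using phi_dL φ hφ n
    have e : φ (Hm τ h j j) = φ (dL n j) := by
      rw [hH, Dmat_eq, Matrix.diagonal_apply_eq]
    rw [Hm_apply, map_sum] at e
    have e2 : ∑ k, t k * ‖φ (h k j)‖ ^ 2 = t j := by
      have : (((∑ k, t k * ‖φ (h k j)‖ ^ 2 : ℝ)) : ℂ) = (t j : ℂ) := by
        rw [ht] at e
        rw [← neg_inj, ← e]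
        push_cast
        rw [← Finset.sum_neg_distrib]
        refine Finset.sum_congr rfl fun k _ => ?_
        rw [map_mul, map_mul, phi_tau τ hτ φ hφ, ht, mul_assoc, Complex.conj_mul']
        ring
      exact_mod_cast this
    have e3 : t i * ‖φ (h i j)‖ ^ 2 ≤ t j := by
      rw [← e2]
      exact Finset.single_le_sum (f := fun k => t k * ‖φ (h k j)‖ ^ 2)
        (fun k _ => mul_nonneg (by linarith [ht1 k]) (by positivity)) (Finset.mem_univ i)
    have := ht1 i
    have := ht2 j
    nlinarith [sq_nonneg (‖φ (h i j)‖), norm_nonneg (φ (h i j))]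

theorem InG_mul {n : ℕ} {τ : L ≃ₐ[ℚ] L} {a b : Matrix (Fin n) (Fin n) L}
    (ha : InG τ a) (hb : InG τ b) : InG τ (a * b) := by
  refine ⟨fun i j => ?_, ?_, ?_⟩
  · rw [Matrix.mul_apply]
    exact IsIntegral.sum _ fun k _ => (ha.1 i k).mul (hb.1 k j)
  · rw [Matrix.det_mul, ha.2.1, hb.2.1, one_mul]
  · rw [Hm_mul, ha.2.2]; exact hb.2.2

theorem InG_one {n : ℕ} (τ : L ≃ₐ[ℚ] L) : InG τ (1 : Matrix (Fin n) (Fin n) L) := by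
  refine ⟨fun i j => ?_, Matrix.det_one, ?_⟩
  · rw [Matrix.one_apply]
    split_ifs
    · exact isIntegral_one
    · exact isIntegral_zero
  · rw [Hm, Matrix.transpose_one, Matrix.map_one _ (map_zero τ) (map_one τ), Matrix.one_mul,
      Matrix.mul_one]

theorem InG_adj {n : ℕ} {τ : L ≃ₐ[ℚ] L} {a : Matrix (Fin n) (Fin n) L}
    (ha : InG τ a) : InG τ a.adjugate := by
  have h1 : a * a.adjugate = 1 := by rw [Matrix.mul_adjugate, ha.2.1, one_smul]
  have hd : a.adjugate.det = 1 := by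
    have := congrArg Matrix.det h1
    rwa [Matrix.det_mul, ha.2.1, one_mul, Matrix.det_one] at this
  refine ⟨fun i j => ?_, hd, ?_⟩
  · rw [Matrix.adjugate_apply]
    refine IsIntegral.det fun k l => ?_
    rw [Matrix.updateRow_apply]
    split_ifs
    · rw [Pi.single_apply]
      split_ifs
      · exact isIntegral_one
      · exact isIntegral_zero
    · exact ha.1 _ _
  · have h2 : Hm τ (a * a.adjugate) = Dmat n := by rw [h1]; exact (InG_one τ).2.2
    rw [Hm_mul, ha.2.2] at h2
    exact h2

theorem iota_det {n : ℕ} (a : Matrix (Fin n) (Fin n) L) : (a.map iota).det = iota a.det := by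
  rw [RingHom.map_det]; rfl

theorem iota_adj {n : ℕ} (a : Matrix (Fin n) (Fin n) L) :
    (a.map iota).adjugate = a.adjugate.map iota :=
  (RingHom.map_adjugate iota a).symm

/-- The subgroup `Γ_n` of `SL_n(ℝ)`. -/
noncomputable def GammaSub (n : ℕ) (τ : L ≃ₐ[ℚ] L) :
    Subgroup (Matrix.SpecialLinearGroup (Fin n) ℝ) where
  carrier := {g | ∃ h : Matrix (Fin n) (Fin n) L, InG τ h ∧
    h.map iota = (g : Matrix (Fin n) (Fin n) ℝ)}
  mul_mem' := by
    rintro a b ⟨x, hx, hxa⟩ ⟨y, hy, hyb⟩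
    refine ⟨x * y, InG_mul hx hy, ?_⟩
    rw [Matrix.SpecialLinearGroup.coe_mul, ← hxa, ← hyb]
    exact Matrix.map_mul
  one_mem' := ⟨1, InG_one τ, by
    rw [Matrix.SpecialLinearGroup.coe_one]
    exact Matrix.map_one _ (map_zero iota) (map_one iota)⟩
  inv_mem' := by
    rintro a ⟨x, hx, hxa⟩
    refine ⟨x.adjugate, InG_adj hx, ?_⟩
    rw [Matrix.SpecialLinearGroup.coe_inv, ← hxa, iota_adj]

theorem SL_inducing (n : ℕ) : Topology.IsInducing
    (fun g : Matrix.SpecialLinearGroup (Fin n) ℝ => (g : Matrix (Fin n) (Fin n) ℝ)) := ⟨rfl⟩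

theorem SL_coe_inj (n : ℕ) : Function.Injective
    (fun g : Matrix.SpecialLinearGroup (Fin n) ℝ => (g : Matrix (Fin n) (Fin n) ℝ)) :=
  Subtype.val_injective

theorem Gamma_discrete (n : ℕ) (τ : L ≃ₐ[ℚ] L) (hτ : τ alphaL = -alphaL) :
    DiscreteTopology (GammaSub n τ) := by
  classical
  set f : GammaSub n τ → Matrix (Fin n) (Fin n) ℝ :=
    fun g => ((g : Matrix.SpecialLinearGroup (Fin n) ℝ) : Matrix (Fin n) (Fin n) ℝ) with hf
  have hfc : Continuous f := (SL_inducing n).continuous.comp continuous_subtype_val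
  have hfi : Function.Injective f := (SL_coe_inj n).comp Subtype.val_injective
  have hT2 : T2Space (GammaSub n τ) := T2Space.of_injective_continuous hfi hfc
  rw [discreteTopology_iff_isOpen_singleton]
  intro γ
  set C : ℝ := ∑ i, ∑ j, (|f γ i j| + |(f γ).adjugate i j|) + 1 with hC
  set U : Set (GammaSub n τ) :=
    {g | (∀ i j, |f g i j| < C) ∧ ∀ i j, |(f g).adjugate i j| < C} with hU
  have hUo : IsOpen U := by
    have h1 : ∀ i j, IsOpen {g : GammaSub n τ | |f g i j| < C} := fun i j =>
      isOpen_lt ((hfc.matrix_elem i j).abs) continuous_const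
    have h2 : ∀ i j, IsOpen {g : GammaSub n τ | |(f g).adjugate i j| < C} := fun i j =>
      isOpen_lt ((hfc.matrix_adjugate.matrix_elem i j).abs) continuous_const
    have : U = (⋂ i, ⋂ j, {g : GammaSub n τ | |f g i j| < C}) ∩
        (⋂ i, ⋂ j, {g : GammaSub n τ | |(f g).adjugate i j| < C}) := by
      ext g; simp [hU]
    rw [this]
    exact (isOpen_iInter_of_finite fun i => isOpen_iInter_of_finite fun j => h1 i j).inter
      (isOpen_iInter_of_finite fun i => isOpen_iInter_of_finite fun j => h2 i j)
  have hle : ∀ i j, |f γ i j| + |(f γ).adjugate i j| < C := by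
    intro i j
    have s1 := Finset.single_le_sum (f := fun j => (|f γ i j| + |(f γ).adjugate i j|))
      (fun j _ => by positivity) (Finset.mem_univ j)
    have s2 := Finset.single_le_sum
      (f := fun i => ∑ j, (|f γ i j| + |(f γ).adjugate i j|))
      (fun i _ => Finset.sum_nonneg fun j _ => by positivity) (Finset.mem_univ i)
    linarith
  have hγU : γ ∈ U := by
    refine ⟨fun i j => ?_, fun i j => ?_⟩
    · have := hle i j
      have := abs_nonneg ((f γ).adjugate i j)
      linarith
    · have := hle i j
      have := abs_nonneg (f γ i j)
      linarith
  have hUfin : U.Finite := by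
    have h1 := ((discrete_finite (n := n) τ hτ C).image
      (fun h : Matrix (Fin n) (Fin n) L => h.map iota)).preimage (f := f) hfi.injOn
    refine h1.subset ?_
    rintro g ⟨hg1, hg2⟩
    obtain ⟨h, hh, hhg⟩ := g.2
    have hfg : f g = h.map iota := hhg.symm
    refine ⟨h, ⟨hh, fun i j => ?_, fun i j => ?_⟩, hhg⟩
    · have := hg1 i j
      rw [hfg] at this
      exact this.le
    · have := hg2 i j
      rw [hfg, iota_adj] at this
      exact this.le
  exact isOpen_singleton_of_finite_mem_nhds γ (hUo.mem_nhds hγU) hUfin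

theorem Gamma_cocompact (n : ℕ) (hn : 2 ≤ n) (τ : L ≃ₐ[ℚ] L) (hτ : τ alphaL = -alphaL) :
    CompactSpace (Matrix.SpecialLinearGroup (Fin n) ℝ ⧸ GammaSub n τ) := by
  classical
  obtain ⟨C, hC⟩ := cocompact_bound hn τ hτ
  set K : Set (Matrix.SpecialLinearGroup (Fin n) ℝ) :=
    {g | ∀ i j, |(g : Matrix (Fin n) (Fin n) ℝ) i j| ≤ C} with hK
  have hKc : IsCompact K := by
    rw [(SL_inducing n).isCompact_iff]
    have himg : (fun g : Matrix.SpecialLinearGroup (Fin n) ℝ =>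
        (g : Matrix (Fin n) (Fin n) ℝ)) '' K
        = {M : Matrix (Fin n) (Fin n) ℝ | ∀ i j, M i j ∈ Set.Icc (-C) C} ∩
          {M | M.det = 1} := by
      ext M
      constructor
      · rintro ⟨g, hg, rfl⟩
        exact ⟨fun i j => abs_le.mp (hg i j), g.2⟩
      · rintro ⟨h1, h2⟩
        exact ⟨⟨M, h2⟩, fun i j => abs_le.mpr (h1 i j), rfl⟩
    rw [himg]
    have c1 : IsCompact {M : Matrix (Fin n) (Fin n) ℝ | ∀ i j, M i j ∈ Set.Icc (-C) C} :=
      isCompact_pi_infinite fun i => isCompact_pi_infinite fun j => isCompact_Icc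
    exact c1.inter_right (isClosed_eq (continuous_id.matrix_det) continuous_const)
  have hcont : Continuous (QuotientGroup.mk :
      Matrix.SpecialLinearGroup (Fin n) ℝ → Matrix.SpecialLinearGroup (Fin n) ℝ ⧸ GammaSub n τ) :=
    continuous_quot_mk
  have himg := hKc.image hcont
  refine ⟨?_⟩
  convert himg
  symm
  rw [Set.eq_univ_iff_forall]
  intro q
  induction q using QuotientGroup.induction_on with
  | H g =>
    obtain ⟨γ, hγ, hb⟩ := hC g g.2
    have hdet : (γ.map iota).det = 1 := by rw [iota_det, hγ.2.1, map_one]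
    set γ' : Matrix.SpecialLinearGroup (Fin n) ℝ := ⟨γ.map iota, hdet⟩ with hγ'
    have hmem : γ' ∈ GammaSub n τ := ⟨γ, hγ, rfl⟩
    refine ⟨g * γ', ?_, ?_⟩
    · intro i j
      exact hb i j
    · exact QuotientGroup.mk_mul_of_mem g hmem

/-- `Γ_n = {g ∈ SL_n(O_L) : τ(gᵀ)·D_n·g = D_n}`, viewed inside `SL_n(ℝ)` via `L ⊂ ℝ`, is a
discrete subgroup of `SL_n(ℝ)` with compact quotient `SL_n(ℝ)/Γ_n`. -/
theorem stmt7 (n : ℕ) (hn : 2 ≤ n) (τ : L ≃ₐ[ℚ] L) (hτ : τ alphaL = -alphaL) :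
    ∃ Γ : Subgroup (Matrix.SpecialLinearGroup (Fin n) ℝ),
      (∀ g : Matrix.SpecialLinearGroup (Fin n) ℝ,
        g ∈ Γ ↔ ∃ h : Matrix (Fin n) (Fin n) L,
          (∀ i j, IsIntegral ℤ (h i j)) ∧ h.det = 1 ∧
          (h.transpose.map τ) * Dmat n * h = Dmat n ∧
          ∀ i j, (h i j : ℝ) = (g : Matrix (Fin n) (Fin n) ℝ) i j) ∧
      DiscreteTopology Γ ∧
      CompactSpace (Matrix.SpecialLinearGroup (Fin n) ℝ ⧸ Γ) := by

  refine ⟨GammaSub n τ, ?_, Gamma_discrete n τ hτ, Gamma_cocompact n hn τ hτ⟩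
  intro g
  constructor
  · rintro ⟨h, ⟨h1, h2, h3⟩, h4⟩
    refine ⟨h, h1, h2, h3, fun i j => ?_⟩
    exact congrFun (congrFun h4 i) j
  · rintro ⟨h, h1, h2, h3, h4⟩
    refine ⟨h, ⟨h1, h2, h3⟩, ?_⟩
    ext i j
    exact h4 i j
end

section
/- For every integer n ≥ 2 there exists a special orthogonal matrix k ∈ SO(n) such that the only traceless diagonal matrix d ∈ Mat_n(ℝ) for which k·d·kᵀ commutes with u is d = 0; equivalently, Ad(k)𝔞 ∩ 𝔭₁ = {0}, where 𝔞 is the space of traceless diagonal real n×n matrices and 𝔭₁ = {A ∈ Mat_n(ℝ) : Aᵀ = A, tr(A) = 0, A·u = u·A}. -/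
open Matrix

/-- `u = diag(1, ..., 1, -(n-1))`. -/
noncomputable def uMat (n : ℕ) : Matrix (Fin n) (Fin n) ℝ :=
  Matrix.diagonal fun i => if (i : ℕ) = n - 1 then -((n : ℝ) - 1) else 1

lemma house_aux (n : ℕ) (hn : 2 ≤ n) (L : Fin n) : ∃ H : Matrix (Fin n) (Fin n) ℝ,
    H.transpose * H = 1 ∧ ∀ j, H L j ≠ 0 := by
  have hn' : (2 : ℝ) ≤ n := by exact_mod_cast hn
  let v : Fin n → ℝ := fun i => if i = L then (n : ℝ) else 1
  have hs : v ⬝ᵥ v = (n : ℝ) ^ 2 + n - 1 := by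
    have : ∀ i, v i * v i = 1 + (if i = L then (n : ℝ) ^ 2 - 1 else 0) := by
      intro i
      by_cases h : i = L
      · simp [v, h]; ring
      · simp [v, h]
    simp only [dotProduct, this, Finset.sum_add_distrib]
    simp
    ring
  have hpos : (0 : ℝ) < (n : ℝ) ^ 2 + n - 1 := by nlinarith
  set a : ℝ := 2 / ((n : ℝ) ^ 2 + n - 1) with ha
  have ha0 : 0 < a := by positivity
  have has : a * ((n : ℝ) ^ 2 + n - 1) = 2 := by rw [ha]; exact div_mul_cancel₀ _ hpos.ne'
  refine ⟨1 - a • vecMulVec v v, ?_, ?_⟩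
  · have ht : (1 - a • vecMulVec v v).transpose = 1 - a • vecMulVec v v := by
      ext i j
      simp [vecMulVec_apply, Matrix.one_apply, eq_comm, mul_comm]
    have hq : vecMulVec v v * vecMulVec v v = ((n : ℝ) ^ 2 + n - 1) • vecMulVec v v := by
      ext i j
      rw [← hs]
      simp only [Matrix.mul_apply, vecMulVec_apply, Matrix.smul_apply, smul_eq_mul, dotProduct,
        Finset.sum_mul]
      exact Finset.sum_congr rfl fun k _ => by ring
    rw [ht, sub_mul, mul_sub, mul_sub, smul_mul_smul_comm, hq, smul_smul, mul_assoc, has]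
    simp only [one_mul, mul_one]
    module
  · intro j
    by_cases h : j = L
    · subst h
      simp only [Matrix.sub_apply, Matrix.one_apply_eq, Matrix.smul_apply, vecMulVec_apply, v,
        if_true, smul_eq_mul]
      intro h0
      nlinarith
    · have h' : L ≠ j := fun e => h e.symm
      simp only [Matrix.sub_apply, Matrix.one_apply_ne h', Matrix.smul_apply, vecMulVec_apply, v,
        if_true, if_neg h, smul_eq_mul]
      have : 0 < a * (n * 1) := by positivity
      intro h0
      linarith

lemma so_aux (n : ℕ) (hn : 2 ≤ n) (L : Fin n) : ∃ H : Matrix (Fin n) (Fin n) ℝ,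
    H.transpose * H = 1 ∧ H.det = 1 ∧ ∀ j, H L j ≠ 0 := by
  obtain ⟨H, h1, h2⟩ := house_aux n hn L
  have hc : H.det * H.det = 1 := by
    have := congrArg Matrix.det h1
    simpa using this
  have hc0 : H.det ≠ 0 := fun h => by simp [h] at hc
  let f : Fin n → ℝ := fun i => if i = L then H.det else 1
  have hf : ∀ i, f i * f i = 1 := by
    intro i
    by_cases h : i = L <;> simp [f, h, hc]
  refine ⟨Matrix.diagonal f * H, ?_, ?_, ?_⟩
  · rw [Matrix.transpose_mul, Matrix.diagonal_transpose, Matrix.mul_assoc,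
      ← Matrix.mul_assoc (Matrix.diagonal f), Matrix.diagonal_mul_diagonal]
    simp [hf, h1]
  · rw [Matrix.det_mul, Matrix.det_diagonal]
    simp [f, hc]
  · intro j
    rw [Matrix.diagonal_mul]
    simp [f, hc0, h2 j]

/-- There exists `k ∈ SO(n)` such that the only traceless diagonal matrix `d` for which
`k·d·kᵀ` commutes with `u` is `d = 0`; i.e. `Ad(k)𝔞 ∩ 𝔭₁ = {0}`. -/
theorem stmt10 (n : ℕ) (hn : 2 ≤ n) :
    ∃ k : Matrix (Fin n) (Fin n) ℝ, k.transpose * k = 1 ∧ k.det = 1 ∧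
      ∀ d : Fin n → ℝ, (∑ i, d i) = 0 →
        (k * Matrix.diagonal d * k.transpose) * uMat n
          = uMat n * (k * Matrix.diagonal d * k.transpose) →
        d = 0 := by
  have hn' : (2 : ℝ) ≤ n := by exact_mod_cast hn
  let L : Fin n := ⟨n - 1, by omega⟩
  obtain ⟨k, h1, h2, h3⟩ := so_aux n hn L
  refine ⟨k, h1, h2, ?_⟩
  intro d hd hcomm
  have hM : k.transpose * (k * Matrix.diagonal d * k.transpose)
      = Matrix.diagonal d * k.transpose := by
    rw [← Matrix.mul_assoc, ← Matrix.mul_assoc, h1, Matrix.one_mul]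
  generalize k * Matrix.diagonal d * k.transpose = M at hcomm hM
  have hz : ∀ i, i ≠ L → M i L = 0 := by
    intro i hi
    have hi' : (i : ℕ) ≠ n - 1 := fun e => hi (Fin.ext e)
    have := congrFun (congrFun hcomm i) L
    simp only [uMat, Matrix.mul_diagonal, Matrix.diagonal_mul, if_neg hi', L, if_true] at this
    have h4 : M i L * n = 0 := by simp only [L]; linarith
    rcases mul_eq_zero.1 h4 with h | h
    · exact h
    · linarith
  have hconst : ∀ j, d j = M L L := by
    intro j
    have := congrFun (congrFun hM j) L
    rw [Matrix.mul_apply, Finset.sum_eq_single L (fun i _ hi => by rw [hz i hi, mul_zero])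
      (by simp), Matrix.diagonal_mul, Matrix.transpose_apply, mul_comm] at this
    exact (mul_right_cancel₀ (h3 j) this).symm
  simp only [hconst, Finset.sum_const, Finset.card_univ, Fintype.card_fin, nsmul_eq_mul] at hd
  funext j
  rw [hconst j]
  rcases mul_eq_zero.1 hd with h | h
  · linarith
  · simpa using h
end

section
/- Let n ≥ 2 and set k = n(n-1)/2. Let 𝔭 = {A ∈ Mat_n(ℝ) : Aᵀ = A, tr(A) = 0} be the space of symmetric traceless real n×n matrices, and let 𝔭₁ = {A ∈ 𝔭 : A·u = u·A}. If η is an alternating ℝ-multilinear k-form on 𝔭 that is invariant under conjugation by special orthogonal matrices, i.e., η(g·v₁·g⁻¹, ..., g·v_k·g⁻¹) = η(v₁, ..., v_k) for every g ∈ SO(n) and all v₁, ..., v_k ∈ 𝔭, then η(v₁, ..., v_k) = 0 whenever all of v₁, ..., v_k lie in the subspace 𝔭₁. -/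
open Matrix

/-- The space `𝔭` of symmetric traceless real `n×n` matrices. -/
def pSp (n : ℕ) : Submodule ℝ (Matrix (Fin n) (Fin n) ℝ) where
  carrier := {A | A.transpose = A ∧ A.trace = 0}
  add_mem' := fun {a b} ha hb =>
    ⟨by rw [Matrix.transpose_add, ha.1, hb.1], by rw [Matrix.trace_add, ha.2, hb.2, add_zero]⟩
  zero_mem' := ⟨Matrix.transpose_zero, Matrix.trace_zero ..⟩
  smul_mem' := fun c a ha =>
    ⟨by rw [Matrix.transpose_smul, ha.1], by rw [Matrix.trace_smul, ha.2, smul_zero]⟩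

/-- A multilinear form on a finite-dimensional space is continuous. -/
lemma multilinear_cont {ι E : Type*} [Fintype ι] [NormedAddCommGroup E] [NormedSpace ℝ E]
    [FiniteDimensional ℝ E] (f : MultilinearMap ℝ (fun _ : ι => E) ℝ) : Continuous f := by
  classical
  let b := Module.finBasis ℝ E
  have h : (f : (ι → E) → ℝ) = fun v => ∑ r : ι → Fin (Module.finrank ℝ E),
      (∏ i, b.coord (r i) (v i)) • f (fun i => b (r i)) := by
    funext v
    have : v = fun i => ∑ j, b.coord j (v i) • b j := by
      funext i
      exact (b.sum_repr (v i)).symm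
    conv_lhs => rw [this]
    rw [MultilinearMap.map_sum]
    refine Finset.sum_congr rfl fun r _ => ?_
    rw [MultilinearMap.map_smul_univ]
  rw [h]
  refine continuous_finsetSum _ (fun r _ => ?_)
  have h1 : ∀ i : ι, Continuous fun v : ι → E => b.coord (r i) (v i) := fun i =>
    (LinearMap.continuous_of_finiteDimensional (b.coord (r i))).comp (continuous_apply i)
  exact Continuous.smul (continuous_finsetProd _ fun i _ => h1 i) continuous_const

section
attribute [local instance] Matrix.linftyOpNormedRing Matrix.linftyOpNormedAlgebra

/-- Infinitesimal form of invariance under conjugation by special orthogonal matrices. -/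
lemma infinitesimal {ι : Type*} [Fintype ι] [DecidableEq ι] {n : ℕ}
    (f : AlternatingMap ℝ (Matrix (Fin n) (Fin n) ℝ) ℝ ι)
    (hf : ∀ g : Matrix (Fin n) (Fin n) ℝ, g.transpose * g = 1 → g.det = 1 →
      ∀ v : ι → Matrix (Fin n) (Fin n) ℝ, f (fun i => g * v i * g.transpose) = f v)
    (X : Matrix (Fin n) (Fin n) ℝ) (hX : X.transpose = -X)
    (v : ι → Matrix (Fin n) (Fin n) ℝ) :
    ∑ i, f (Function.update v i (X * v i - v i * X)) = 0 := by
  have hT : ∀ t : ℝ, (NormedSpace.exp (t • X)).transpose = NormedSpace.exp (t • (-X)) := by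
    intro t
    rw [← Matrix.exp_transpose, Matrix.transpose_smul, hX]
  have hO : ∀ t : ℝ, (NormedSpace.exp (t • X)).transpose * NormedSpace.exp (t • X) = 1 := by
    intro t
    rw [hT, ← Matrix.exp_add_of_commute]
    · simp
    · simp only [smul_neg]
      exact (Commute.refl _).neg_left
  have hD : ∀ t : ℝ, (NormedSpace.exp (t • X)).det = 1 := by
    intro t
    have h1 : NormedSpace.exp (t • X)
        = NormedSpace.exp ((t / 2) • X) * NormedSpace.exp ((t / 2) • X) := by
      rw [← Matrix.exp_add_of_commute _ _ (Commute.refl _), ← add_smul]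
      congr 2
      ring
    have h2 := congrArg Matrix.det (hO (t / 2))
    rw [Matrix.det_mul, Matrix.det_transpose, Matrix.det_one] at h2
    rw [h1, Matrix.det_mul, h2]
  let F : ContinuousMultilinearMap ℝ (fun _ : ι => Matrix (Fin n) (Fin n) ℝ) ℝ :=
    ⟨f.toMultilinearMap, multilinear_cont _⟩
  have hd : ∀ i, HasDerivAt
      (fun t : ℝ => NormedSpace.exp (t • X) * v i * NormedSpace.exp (t • (-X)))
      (X * v i - v i * X) 0 := by
    intro i
    have h1 := hasDerivAt_exp_smul_const X (0 : ℝ)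
    have h2 := hasDerivAt_exp_smul_const (-X) (0 : ℝ)
    have h3 := (h1.mul_const (v i)).mul h2
    refine HasDerivAt.congr_deriv h3 ?_
    simp [sub_eq_add_neg]
  have h := (HasFDerivAt.multilinear_comp F (fun i => (hd i).hasFDerivAt)).hasDerivAt
  have hc : (fun t : ℝ => F fun i =>
      NormedSpace.exp (t • X) * v i * NormedSpace.exp (t • (-X))) = fun _ => f v := by
    funext t
    rw [← hf _ (hO t) (hD t) v, hT]
    rfl
  have h0 := h.unique ((hasDerivAt_const (0 : ℝ) (f v)).congr_of_eventuallyEq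
    (Filter.Eventually.of_forall (congrFun hc)))
  simp only [FunLike.coe_sum, Finset.sum_apply, zero_smul, NormedSpace.exp_zero,
    one_mul, mul_one] at h0
  refine (Finset.sum_congr rfl fun i _ => ?_).trans h0
  change _ = f (Function.update (fun j => v j) i ((1 : ℝ) • (X * v i - v i * X)))
  rw [one_smul]

end

/-- The symmetric elementary matrix. -/
def eSym {n : ℕ} (a b : Fin n) : Matrix (Fin n) (Fin n) ℝ :=
  Matrix.single a b 1 + Matrix.single b a 1

/-- The elementary skew matrix. -/
def xSk {n : ℕ} (p q : Fin n) : Matrix (Fin n) (Fin n) ℝ :=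
  Matrix.single p q 1 - Matrix.single q p 1

lemma xSk_transpose {n : ℕ} (p q : Fin n) : (xSk p q).transpose = - xSk p q := by
  simp [xSk]

lemma eSym_comm {n : ℕ} (a b : Fin n) : eSym a b = eSym b a := by
  simp [eSym, add_comm]

lemma comm_eSym {n : ℕ} (p q a b : Fin n) :
    xSk p q * eSym a b - eSym a b * xSk p q =
      (if q = a then eSym p b else 0) + (if q = b then eSym p a else 0)
      - (if p = a then eSym q b else 0) - (if p = b then eSym q a else 0) := by
  have key : ∀ a b c d : Fin n, Matrix.single a b (1 : ℝ) * Matrix.single c d (1 : ℝ)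
      = if b = c then Matrix.single a d 1 else 0 := by
    intro a b c d
    split_ifs with h
    · subst h; simp
    · simp [h]
  simp only [xSk, eSym, mul_add, add_mul, sub_mul, mul_sub, key, eq_comm (a := a) (b := p),
    eq_comm (a := a) (b := q), eq_comm (a := b) (b := p), eq_comm (a := b) (b := q)]
  split_ifs <;> abel

/-- The basis of `𝔭₁`, as a function of two indices. -/
def bF (m : ℕ) (a b : Fin (m + 1)) : Matrix (Fin (m + 2)) (Fin (m + 2)) ℝ :=
  if a = b then
    (if a = 0 then eSym 0 0 - eSym (Fin.last _) (Fin.last _)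
      else eSym a.castSucc a.castSucc - eSym 0 0)
  else eSym a.castSucc b.castSucc

lemma bF_comm (m : ℕ) (a b : Fin (m + 1)) : bF m a b = bF m b a := by
  by_cases h : a = b
  · rw [h]
  · rw [bF, bF, if_neg h, if_neg (Ne.symm h), eSym_comm]

/-- The basis of `𝔭₁`, indexed by unordered pairs. -/
def bS (m : ℕ) : Sym2 (Fin (m + 1)) → Matrix (Fin (m + 2)) (Fin (m + 2)) ℝ :=
  Sym2.lift ⟨bF m, bF_comm m⟩

lemma bS_mk (m : ℕ) (a b : Fin (m + 1)) : bS m s(a, b) = bF m a b := rfl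

lemma bS_zero (m : ℕ) : bS m s(0, 0) = eSym 0 0 - eSym (Fin.last _) (Fin.last _) := by
  simp [bS_mk, bF]

lemma bS_diag (m : ℕ) (a : Fin (m + 1)) (h : a ≠ 0) :
    bS m s(a, a) = eSym a.castSucc a.castSucc - eSym 0 0 := by
  simp [bS_mk, bF, h]

lemma bS_off (m : ℕ) (a b : Fin (m + 1)) (h : a ≠ b) :
    bS m s(a, b) = eSym a.castSucc b.castSucc := by
  simp [bS_mk, bF, h]

lemma dup_zero {ι E : Type*} [DecidableEq ι] [AddCommGroup E] [Module ℝ E]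
    (f : AlternatingMap ℝ E ℝ ι) (v : ι → E) (s t : ι) (hst : s ≠ t) (c : ℝ) (Z : E)
    (hZ : Z = c • v t) : f (Function.update v s Z) = 0 := by
  rw [hZ, f.map_update_smul, f.map_update_self _ hst, smul_zero]

lemma comm_diag {n : ℕ} (p q a b : Fin n) :
    xSk p q * (eSym a a - eSym b b) - (eSym a a - eSym b b) * xSk p q =
    ((if q = a then 2 else 0) - (if p = a then 2 else 0) - (if q = b then 2 else 0)
      + (if p = b then 2 else 0) : ℝ) • eSym p q := by
  have h : xSk p q * (eSym a a - eSym b b) - (eSym a a - eSym b b) * xSk p q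
     = (xSk p q * eSym a a - eSym a a * xSk p q) - (xSk p q * eSym b b - eSym b b * xSk p q) := by
    rw [mul_sub, sub_mul]; abel
  rw [h, comm_eSym, comm_eSym]
  have e := eSym_comm p q
  split_ifs <;> subst_vars <;> (try simp only [e]) <;> module

section
variable {m : ℕ} (f : AlternatingMap ℝ (Matrix (Fin (m + 2)) (Fin (m + 2)) ℝ) ℝ (Sym2 (Fin (m + 1))))

lemma step2
    (hf : ∀ (p q : Fin (m + 2)) (v : Sym2 (Fin (m + 1)) → Matrix (Fin (m + 2)) (Fin (m + 2)) ℝ),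
      ∑ i, f (Function.update v i (xSk p q * v i - v i * xSk p q)) = 0)
    (j : Fin (m + 1)) (hj : j ≠ 0) :
    f (Function.update (Function.update (bS m) s(0, 0) (eSym 0 (Fin.last _)))
      s(0, j) (eSym (Fin.last _) j.castSucc)) = 0 := by
  set w := Function.update (Function.update (bS m) s(0, 0) (eSym 0 (Fin.last _)))
      s(0, j) (eSym (Fin.last _) j.castSucc) with hw
  set y := Function.update w s(j, j) (eSym 0 j.castSucc) with hy
  have hj' : j.castSucc ≠ 0 := by simpa using hj
  have hl : j.castSucc ≠ Fin.last _ := Fin.castSucc_ne_last j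
  have hl0 : (Fin.last (m + 1)) ≠ 0 := by simp
  have hy1 : y s(0, 0) = eSym 0 (Fin.last _) := by simp [hy, hw, hj.symm]
  have hy2 : y s(0, j) = eSym (Fin.last _) j.castSucc := by simp [hy, hw, hj.symm]
  have hy3 : y s(j, j) = eSym 0 j.castSucc := by simp [hy]
  have hy4 : ∀ s, s ≠ s(0, 0) → s ≠ s(0, j) → s ≠ s(j, j) → y s = bS m s := by
    intro s h1 h2 h3
    simp [hy, hw, h1, h2, h3]
  have h := hf 0 j.castSucc y
  rw [Finset.sum_eq_single s(j, j)] at h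
  · have hwj : w s(j, j) = bS m s(j, j) := by simp [hw, hj]
    have e : xSk 0 j.castSucc * eSym 0 j.castSucc - eSym 0 j.castSucc * xSk 0 j.castSucc
        = (-1 : ℝ) • w s(j, j) := by
      rw [hwj, comm_eSym, bS_diag m j hj]
      simp [hj', hj'.symm]
    rw [hy3, e, f.map_update_smul, hy, Function.update_idem, Function.update_eq_self] at h
    simpa using h
  · intro s _ hs
    induction s using Sym2.ind with | _ a b => ?_
    by_cases hab : a = b
    · subst hab
      by_cases ha : a = 0
      · subst ha
        refine dup_zero f y _ s(0, j) (by simp [hj.symm]) (-1) _ ?_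
        rw [hy1, hy2, comm_eSym]
        simp [hj', hl, hl0.symm, eSym_comm]
      · have haj : a ≠ j := fun h => hs (by rw [h])
        have ha' : a.castSucc ≠ 0 := by simpa using ha
        refine dup_zero f y _ s(j, j) hs 2 _ ?_
        rw [hy3, hy4 _ (by simp [ha]) (by simp [ha]) hs, bS_diag m a ha, comm_diag]
        simp [hj', ha'.symm, haj.symm]
    · -- off-diagonal, normalised
      have hoff : ∀ c : Fin (m + 1), c ≠ 0 →
          f (Function.update y s(0, c) (xSk 0 j.castSucc * y s(0, c)
            - y s(0, c) * xSk 0 j.castSucc)) = 0 := by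
        intro c hc
        have hc' : c.castSucc ≠ 0 := by simpa using hc
        by_cases hcj : c = j
        · subst hcj
          refine dup_zero f y _ s(0, 0) (by simp [hj]) 1 _ ?_
          rw [hy1, hy2, comm_eSym]
          simp [hj'.symm, hl, hl0.symm, eSym_comm]
        · refine dup_zero f y _ s(j, c) (by simp [hj.symm, hc.symm]) (-1) _ ?_
          rw [hy4 s(0, c) (by simp [hc]) (by simp [hcj, hc]) (by simp [hj.symm]),
            hy4 s(j, c) (by simp [hc]) (by simp [hj, hc]) (by simp [hcj]),
            bS_off m 0 c hc.symm, bS_off m j c (Ne.symm hcj), comm_eSym]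
          simp [hj', hc'.symm, Ne.symm hcj]
      have hoffj : ∀ c : Fin (m + 1), c ≠ 0 → c ≠ j →
          f (Function.update y s(j, c) (xSk 0 j.castSucc * y s(j, c)
            - y s(j, c) * xSk 0 j.castSucc)) = 0 := by
        intro c hc hcj
        have hc' : c.castSucc ≠ 0 := by simpa using hc
        refine dup_zero f y _ s(0, c) (by simp [hj, hc]) 1 _ ?_
        rw [hy4 s(0, c) (by simp [hc]) (by simp [hcj, hc]) (by simp [hj.symm]),
            hy4 s(j, c) (by simp [hc]) (by simp [hj, hc]) (by simp [hcj]),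
            bS_off m 0 c hc.symm, bS_off m j c (Ne.symm hcj), comm_eSym]
        simp [hj'.symm, hc'.symm, Ne.symm hcj]
      by_cases ha : a = 0
      · subst ha
        exact hoff b (Ne.symm hab)
      by_cases hb : b = 0
      · subst hb
        rw [Sym2.eq_swap]
        exact hoff a ha
      by_cases haj : a = j
      · subst haj
        exact hoffj b hb (Ne.symm hab)
      by_cases hbj : b = j
      · subst hbj
        rw [Sym2.eq_swap]
        exact hoffj a ha haj
      have ha' : a.castSucc ≠ 0 := by simpa using ha
      have hb' : b.castSucc ≠ 0 := by simpa using hb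
      refine dup_zero f y _ s(j, j) hs 0 _ ?_
      rw [hy4 _ (by simp [ha]) (by simp [ha, hb]) hs, bS_off m a b hab, comm_eSym]
      simp [ha'.symm, hb'.symm, Ne.symm haj, Ne.symm hbj]
  · simp

lemma step1
    (hf : ∀ (p q : Fin (m + 2)) (v : Sym2 (Fin (m + 1)) → Matrix (Fin (m + 2)) (Fin (m + 2)) ℝ),
      ∑ i, f (Function.update v i (xSk p q * v i - v i * xSk p q)) = 0) :
    f (bS m) = 0 := by
  set w := Function.update (bS m) s(0, 0) (eSym 0 (Fin.last _)) with hw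
  have hl0 : (Fin.last (m + 1)) ≠ 0 := by simp
  have hw1 : w s(0, 0) = eSym 0 (Fin.last _) := by simp [hw]
  have hw2 : ∀ s, s ≠ s(0, 0) → w s = bS m s := by
    intro s h1
    simp [hw, h1]
  have h := hf 0 (Fin.last _) w
  rw [Finset.sum_eq_single s(0, 0)] at h
  · have e : xSk 0 (Fin.last (m + 1)) * eSym 0 (Fin.last (m + 1))
        - eSym 0 (Fin.last (m + 1)) * xSk 0 (Fin.last (m + 1)) = bS m s(0, 0) := by
      rw [comm_eSym, bS_zero]
      simp
    rw [hw1, e, hw, Function.update_idem, Function.update_eq_self] at h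
    exact h
  · intro s _ hs
    induction s using Sym2.ind with | _ a b => ?_
    have hla := Fin.castSucc_ne_last a
    have hlb := Fin.castSucc_ne_last b
    by_cases hab : a = b
    · subst hab
      have ha : a ≠ 0 := fun h => hs (by rw [h])
      have ha' : a.castSucc ≠ 0 := by simpa using ha
      refine dup_zero f w _ s(0, 0) hs 2 _ ?_
      rw [hw1, hw2 _ hs, bS_diag m a ha, comm_diag]
      simp [ha'.symm, hla.symm]
    · have hoff : ∀ c : Fin (m + 1), c ≠ 0 →
          f (Function.update w s(0, c) (xSk 0 (Fin.last _) * w s(0, c)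
            - w s(0, c) * xSk 0 (Fin.last _))) = 0 := by
        intro c hc
        have hc' : c.castSucc ≠ 0 := by simpa using hc
        have hlc := Fin.castSucc_ne_last c
        have e : xSk 0 (Fin.last _) * w s(0, c) - w s(0, c) * xSk 0 (Fin.last _)
            = (-1 : ℝ) • eSym (Fin.last _) c.castSucc := by
          rw [hw2 _ (by simp [hc]), bS_off m 0 c hc.symm, comm_eSym]
          simp [hc'.symm, hlc.symm]
        rw [e, f.map_update_smul, step2 f hf c hc, smul_zero]
      by_cases ha : a = 0
      · subst ha
        exact hoff b (Ne.symm hab)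
      by_cases hb : b = 0
      · subst hb
        rw [Sym2.eq_swap]
        exact hoff a ha
      have ha' : a.castSucc ≠ 0 := by simpa using ha
      have hb' : b.castSucc ≠ 0 := by simpa using hb
      refine dup_zero f w _ s(0, 0) hs 0 _ ?_
      rw [hw2 _ hs, bS_off m a b hab, comm_eSym]
      simp [ha'.symm, hb'.symm, hla.symm, hlb.symm]
  · simp

end

lemma bS_off_apply (m : ℕ) (s : Sym2 (Fin (m + 1))) (a b : Fin (m + 1)) (h : a ≠ b) :
    bS m s a.castSucc b.castSucc = if s = s(a, b) then 1 else 0 := by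
  induction s using Sym2.ind with | _ c d => ?_
  have hla := Fin.castSucc_ne_last a
  have hlb := Fin.castSucc_ne_last b
  have h0 : (0 : Fin (m + 2)) = (0 : Fin (m + 1)).castSucc := rfl
  rw [bS_mk, bF, h0]
  by_cases hcd : c = d
  · subst hcd
    by_cases hc : c = 0 <;> simp [hc, eSym, Matrix.single_apply] <;> grind
  · simp only [hcd, if_false, eSym, Matrix.add_apply, Matrix.single_apply, Fin.castSucc_inj,
      Sym2.eq_iff]
    grind

lemma bS_diag_apply (m : ℕ) (s : Sym2 (Fin (m + 1))) (a : Fin (m + 1)) (h : a ≠ 0) :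
    bS m s a.castSucc a.castSucc = if s = s(a, a) then 2 else 0 := by
  induction s using Sym2.ind with | _ c d => ?_
  have hla := Fin.castSucc_ne_last a
  have h0 : (0 : Fin (m + 2)) = (0 : Fin (m + 1)).castSucc := rfl
  rw [bS_mk, bF, h0]
  by_cases hcd : c = d
  · subst hcd
    by_cases hc : c = 0 <;> simp only [hc, eSym, Matrix.single_apply, Matrix.add_apply,
      Matrix.sub_apply, Fin.castSucc_inj, Sym2.eq_iff, if_true, if_false] <;> grind
  · simp only [hcd, if_false, eSym, Matrix.add_apply, Matrix.single_apply, Fin.castSucc_inj,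
      Sym2.eq_iff]
    grind

lemma bS_last_apply (m : ℕ) (s : Sym2 (Fin (m + 1))) :
    bS m s (Fin.last _) (Fin.last _) = if s = s(0, 0) then -2 else 0 := by
  induction s using Sym2.ind with | _ c d => ?_
  have hlc := Fin.castSucc_ne_last c
  have hld := Fin.castSucc_ne_last d
  have h0 : (0 : Fin (m + 2)) ≠ Fin.last _ := (Fin.castSucc_ne_last (0 : Fin (m + 1)))
  rw [bS_mk, bF]
  simp only [Sym2.eq_iff]
  split_ifs <;> simp only [eSym, Matrix.single_apply, Matrix.add_apply,
      Matrix.sub_apply] <;> grind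

lemma bS_mixed_apply (m : ℕ) (s : Sym2 (Fin (m + 1))) (a : Fin (m + 1)) :
    bS m s a.castSucc (Fin.last _) = 0 := by
  induction s using Sym2.ind with | _ c d => ?_
  have hlc := Fin.castSucc_ne_last c
  have hld := Fin.castSucc_ne_last d
  have hla := Fin.castSucc_ne_last a
  have h0 : (0 : Fin (m + 2)) ≠ Fin.last _ := (Fin.castSucc_ne_last (0 : Fin (m + 1)))
  rw [bS_mk, bF]
  split_ifs <;> simp only [eSym, Matrix.single_apply, Matrix.add_apply,
      Matrix.sub_apply] <;> grind

lemma bS_transpose (m : ℕ) (s : Sym2 (Fin (m + 1))) : (bS m s).transpose = bS m s := by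
  induction s using Sym2.ind with | _ c d => ?_
  have h : ∀ a b : Fin (m + 2), (eSym a b).transpose = eSym a b := by
    intro a b
    simp [eSym, add_comm]
  rw [bS_mk, bF]
  split_ifs <;> simp [h]

lemma bS_trace (m : ℕ) (s : Sym2 (Fin (m + 1))) : (bS m s).trace = 0 := by
  induction s using Sym2.ind with | _ c d => ?_
  have h : ∀ a : Fin (m + 2), (eSym a a).trace = 2 := by
    intro a
    simp [eSym]; norm_num
  rw [bS_mk, bF]
  split_ifs with h1
  · simp [h]
  · simp [h]
  · simp [eSym, h1, Ne.symm h1]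

lemma exists_coeff (m : ℕ) (A : Matrix (Fin (m + 2)) (Fin (m + 2)) ℝ)
    (hA : A.transpose = A) (hT : A.trace = 0) (hu : A * uMat (m + 2) = uMat (m + 2) * A) :
    ∃ c : Sym2 (Fin (m + 1)) → ℝ, Fintype.linearCombination ℝ (bS m) c = A := by
  have hs : ∀ i j, A i j = A j i := fun i j => congrFun (congrFun hA j) i
  have hmix : ∀ a : Fin (m + 1), A a.castSucc (Fin.last _) = 0 := by
    intro a
    have h := congrFun (congrFun hu a.castSucc) (Fin.last _)
    have ha : (a : ℕ) ≠ m + 1 := by omega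
    simp [uMat, Matrix.mul_diagonal, Matrix.diagonal_mul, ha] at h
    have h2 : A a.castSucc (Fin.last _) * ((m : ℝ) + 2) = 0 := by linarith
    have h3 : (m : ℝ) + 2 ≠ 0 := by positivity
    exact (mul_eq_zero.mp h2).resolve_right h3
  let c : Sym2 (Fin (m + 1)) → ℝ := Sym2.lift ⟨fun a b =>
    if a = b then (if a = 0 then - A (Fin.last _) (Fin.last _) / 2
      else A a.castSucc a.castSucc / 2) else A a.castSucc b.castSucc, by
    intro a b
    by_cases h : a = b
    · rw [h]
    · dsimp only
      rw [if_neg h, if_neg (Ne.symm h), hs]⟩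
  have hc : ∀ a b, c s(a, b) = if a = b then (if a = 0 then - A (Fin.last _) (Fin.last _) / 2
      else A a.castSucc a.castSucc / 2) else A a.castSucc b.castSucc := fun a b => rfl
  refine ⟨c, ?_⟩
  set M := Fintype.linearCombination ℝ (bS m) c with hM
  have hMe : ∀ i j, M i j = ∑ s, c s * bS m s i j := by
    intro i j
    rw [hM, Fintype.linearCombination_apply, Matrix.sum_apply]
    rfl
  have hMs : ∀ i j, M i j = M j i := by
    intro i j
    rw [hMe, hMe]
    refine Finset.sum_congr rfl fun s _ => ?_
    rw [← congrFun (congrFun (bS_transpose m s) j) i, Matrix.transpose_apply]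
  have hMt : M.trace = 0 := by
    rw [hM, Fintype.linearCombination_apply, Matrix.trace_sum]
    exact Finset.sum_eq_zero fun s _ => by rw [Matrix.trace_smul, bS_trace, smul_zero]
  have hlast : M (Fin.last _) (Fin.last _) = A (Fin.last _) (Fin.last _) := by
    rw [hMe]
    simp [bS_last_apply, hc]
  have hmixM : ∀ a : Fin (m + 1), M a.castSucc (Fin.last _) = 0 := by
    intro a
    rw [hMe]
    simp [bS_mixed_apply]
  have hdiag : ∀ a : Fin (m + 1), a ≠ 0 → M a.castSucc a.castSucc = A a.castSucc a.castSucc := by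
    intro a ha
    rw [hMe]
    simp [bS_diag_apply _ _ _ ha, hc, ha]
  have hoff : ∀ a b : Fin (m + 1), a ≠ b → M a.castSucc b.castSucc = A a.castSucc b.castSucc := by
    intro a b hab
    rw [hMe]
    simp [bS_off_apply _ _ _ _ hab, hc, hab]
  have hzero : M (Fin.castSucc 0) (Fin.castSucc 0) = A (Fin.castSucc 0) (Fin.castSucc 0) := by
    have h := hMt.trans hT.symm
    have hsplit : ∀ N : Matrix (Fin (m + 2)) (Fin (m + 2)) ℝ, N.trace =
        N (Fin.castSucc 0) (Fin.castSucc 0) + ∑ i : Fin m, N i.succ.castSucc i.succ.castSucc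
          + N (Fin.last _) (Fin.last _) := by
      intro N
      rw [Matrix.trace, Fin.sum_univ_castSucc (fun i => N.diag i),
        Fin.sum_univ_succ (fun i : Fin (m + 1) => N.diag i.castSucc)]
      rfl
    rw [hsplit M, hsplit A, hlast] at h
    have h2 : ∑ i : Fin m, M i.succ.castSucc i.succ.castSucc
        = ∑ i : Fin m, A i.succ.castSucc i.succ.castSucc :=
      Finset.sum_congr rfl fun i _ => hdiag _ (Fin.succ_ne_zero i)
    linarith
  ext i j
  refine Fin.lastCases ?_ (fun a => ?_) i <;> refine Fin.lastCases ?_ (fun b => ?_) j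
  · exact hlast
  · rw [hMs, hs, hmixM, hmix]
  · rw [hmixM, hmix]
  · by_cases hab : a = b
    · subst hab
      by_cases ha : a = 0
      · subst ha; exact hzero
      · exact hdiag a ha
    · exact hoff a b hab

/-- Equivariant projection of all matrices onto `𝔭`. -/
noncomputable def proj (n : ℕ) (hn : n ≠ 0) : Matrix (Fin n) (Fin n) ℝ →ₗ[ℝ] pSp n where
  toFun A := ⟨(1 / 2 : ℝ) • (A + A.transpose) - (A.trace / n) • (1 : Matrix (Fin n) (Fin n) ℝ), by
    have h : (n : ℝ) ≠ 0 := by exact_mod_cast hn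
    constructor
    · simp [add_comm]
    · simp
      field_simp
      ring⟩
  map_add' A B := by
    ext1
    simp only [Matrix.trace_add, Matrix.transpose_add, Submodule.coe_add]
    module
  map_smul' r A := by
    ext1
    simp only [Matrix.trace_smul, Matrix.transpose_smul, Submodule.coe_smul, RingHom.id_apply,
      smul_eq_mul]
    module

lemma proj_coe (n : ℕ) (hn : n ≠ 0) (A : Matrix (Fin n) (Fin n) ℝ) :
    (proj n hn A : Matrix (Fin n) (Fin n) ℝ) =
      (1 / 2 : ℝ) • (A + A.transpose) - (A.trace / n) • (1 : Matrix (Fin n) (Fin n) ℝ) := rfl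

lemma proj_self (n : ℕ) (hn : n ≠ 0) (A : pSp n) : proj n hn A = A := by
  ext1
  rw [proj_coe, A.2.1, A.2.2]
  simp only [zero_div, zero_smul, sub_zero]
  module

/-- Any alternating `k`-form (`k = n(n-1)/2`) on the space `𝔭` of symmetric traceless matrices
which is invariant under conjugation by special orthogonal matrices vanishes on `k`-tuples of
vectors lying in `𝔭₁ = {A ∈ 𝔭 : A·u = u·A}`. -/
theorem stmt13 (n : ℕ) (hn : 2 ≤ n)
    (η : AlternatingMap ℝ (pSp n) ℝ (Fin (n * (n - 1) / 2)))
    (hinv : ∀ g : Matrix (Fin n) (Fin n) ℝ, g.transpose * g = 1 → g.det = 1 →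
      ∀ v w : Fin (n * (n - 1) / 2) → pSp n,
        (∀ i, (w i : Matrix (Fin n) (Fin n) ℝ)
            = g * (v i : Matrix (Fin n) (Fin n) ℝ) * g⁻¹) →
        η w = η v)
    (v : Fin (n * (n - 1) / 2) → pSp n)
    (hv : ∀ i, (v i : Matrix (Fin n) (Fin n) ℝ) * uMat n
        = uMat n * (v i : Matrix (Fin n) (Fin n) ℝ)) :
    η v = 0 := by
  obtain ⟨m, rfl⟩ : ∃ m, n = m + 2 := ⟨n - 2, by omega⟩
  have hn0 : m + 2 ≠ 0 := by omega
  have hcard : Fintype.card (Sym2 (Fin (m + 1))) = (m + 2) * (m + 2 - 1) / 2 := by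
    rw [Sym2.card, Fintype.card_fin, Nat.choose_two_right]
  let e : Fin ((m + 2) * (m + 2 - 1) / 2) ≃ Sym2 (Fin (m + 1)) :=
    (Fintype.equivFinOfCardEq hcard).symm
  let f := (η.compLinearMap (proj (m + 2) hn0)).domDomCongr e
  have hfa : ∀ w, f w = η (fun i => proj (m + 2) hn0 (w (e i))) := fun w => rfl
  have hf : ∀ g : Matrix (Fin (m + 2)) (Fin (m + 2)) ℝ, g.transpose * g = 1 → g.det = 1 →
      ∀ w, f (fun i => g * w i * g.transpose) = f w := by
    intro g hg hd w
    rw [hfa, hfa]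
    refine hinv g hg hd _ _ fun i => ?_
    have hgi : g⁻¹ = g.transpose := Matrix.inv_eq_left_inv hg
    have hg2 : g * g.transpose = 1 := mul_eq_one_comm.mp hg
    rw [hgi, proj_coe, proj_coe]
    have ht : (g * w (e i) * g.transpose).trace = (w (e i)).trace := by
      rw [Matrix.trace_mul_comm, ← Matrix.mul_assoc, hg, Matrix.one_mul]
    rw [ht]
    simp only [Matrix.transpose_mul, Matrix.transpose_transpose, Matrix.mul_sub, Matrix.sub_mul,
      Matrix.mul_smul, Matrix.smul_mul, Matrix.mul_add, Matrix.add_mul, Matrix.mul_one, hg2,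
      Matrix.mul_assoc]
  have h1 : f (bS m) = 0 := step1 f fun p q w => infinitesimal f hf _ (xSk_transpose p q) w
  have h2 : f.compLinearMap (Fintype.linearCombination ℝ (bS m)) = 0 := by
    rw [← AlternatingMap.map_basis_eq_zero_iff (Pi.basisFun ℝ (Sym2 (Fin (m + 1))))]
    rw [AlternatingMap.compLinearMap_apply, ← h1]
    congr 1
    funext s
    simp
  choose c hc using fun i => exists_coeff m (v i) (v i).2.1 (v i).2.2 (hv i)
  have h3 := congrArg (fun F => F (fun s => c (e.symm s))) h2
  simp only [AlternatingMap.compLinearMap_apply, hc, AlternatingMap.zero_apply] at h3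
  rw [hfa] at h3
  simpa [proj_self] using h3
end

section
/- Let n ≥ 1 and let t, u ∈ Mat_n(ℝ). Assume: (i) every g ∈ SL_n(ℝ) satisfying g·t = t·g and g·u = u·g is a special orthogonal matrix, and (ii) the set of special orthogonal matrices g with g·t = t·g is finite. Then every matrix s ∈ Mat_n(ℝ) satisfying s·t = t·s and s·u = u·s is a scalar multiple of the identity matrix; in particular, the solution space {s ∈ Mat_n(ℝ) : s·t = t·s, s·u = u·s} is one-dimensional, spanned by I_n. -/
open Matrix

/-- If every `g ∈ SL_n(ℝ)` commuting with both `t` and `u` is special orthogonal, and only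
finitely many special orthogonal matrices commute with `t`, then every matrix commuting with
both `t` and `u` is a scalar multiple of the identity: the solution space
`{s : s·t = t·s, s·u = u·s}` is one-dimensional, spanned by `I`. -/
theorem stmt14 (n : ℕ) (hn : 1 ≤ n) (t u : Matrix (Fin n) (Fin n) ℝ)
    (h1 : ∀ g : Matrix (Fin n) (Fin n) ℝ, g.det = 1 → g * t = t * g → g * u = u * g →
      g.transpose * g = 1)
    (h2 : {g : Matrix (Fin n) (Fin n) ℝ |
      g.transpose * g = 1 ∧ g.det = 1 ∧ g * t = t * g}.Finite) :
    ∀ s : Matrix (Fin n) (Fin n) ℝ, s * t = t * s → s * u = u * s →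
      ∃ c : ℝ, s = c • (1 : Matrix (Fin n) (Fin n) ℝ) := by
  intro s hst hsu
  have hn0 : n ≠ 0 := by omega
  have hcont : Continuous fun x : ℝ => (1 + x • s).det := by
    apply Continuous.matrix_det
    fun_prop
  have hS : {x : ℝ | 0 < (1 + x • s).det} ∈ nhds (0 : ℝ) := by
    apply (isOpen_lt continuous_const hcont).mem_nhds
    simp
  have hinf := infinite_of_mem_nhds (0 : ℝ) hS
  let a : ℝ → ℝ := fun x => (((1 + x • s).det) ^ ((n : ℝ)⁻¹))⁻¹
  have ha : ∀ x : ℝ, 0 < (1 + x • s).det → 0 < a x := fun x hx =>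
    inv_pos.mpr (Real.rpow_pos_of_pos hx _)
  have hmap : Set.MapsTo (fun x : ℝ => a x • (1 + x • s)) {x : ℝ | 0 < (1 + x • s).det}
      {g : Matrix (Fin n) (Fin n) ℝ |
        g.transpose * g = 1 ∧ g.det = 1 ∧ g * t = t * g} := by
    intro x hx
    have hx' : 0 < (1 + x • s).det := hx
    have hdet : (a x • (1 + x • s)).det = 1 := by
      rw [Matrix.det_smul, Fintype.card_fin]
      simp only [a]
      rw [inv_pow, Real.rpow_inv_natCast_pow hx'.le hn0]
      exact inv_mul_cancel₀ hx'.ne'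
    have hc : ∀ w : Matrix (Fin n) (Fin n) ℝ, s * w = w * s →
        (a x • (1 + x • s)) * w = w * (a x • (1 + x • s)) := by
      intro w hw
      simp only [smul_mul_assoc, mul_smul_comm, add_mul, mul_add, one_mul, mul_one, hw]
    exact ⟨h1 _ hdet (hc t hst) (hc u hsu), hdet, hc t hst⟩
  obtain ⟨x, hx, y, hy, hxy, he⟩ := hinf.exists_ne_map_eq_of_mapsTo hmap h2
  have hax := ha x hx
  have key : (a x * x - a y * y) • s = (a y - a x) • (1 : Matrix (Fin n) (Fin n) ℝ) := by
    simp only [smul_add, smul_smul] at he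
    rw [sub_smul, sub_smul, sub_eq_sub_iff_add_eq_add, add_comm, he, add_comm]
  by_cases h0 : a x * x - a y * y = 0
  · exfalso
    rw [h0, zero_smul] at key
    have h00 := congrFun (congrFun key ⟨0, by omega⟩) ⟨0, by omega⟩
    simp at h00
    have hay : a y = a x := by linarith
    rw [hay] at h0
    apply hxy
    apply mul_left_cancel₀ hax.ne'
    linarith
  · refine ⟨(a x * x - a y * y)⁻¹ * (a y - a x), ?_⟩
    rw [← smul_smul, ← key, smul_smul, inv_mul_cancel₀ h0, one_smul]
end
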